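/- Assume the standing assumptions, the parameter conditions, λ⁻¹ > L_g, α ≤ ε⁻¹, and let {(X^k, Y^k, Z^k)} be generated by LSALM. Let ξ > 0, δ ∈ (0,1), and let K be a positive integer such that ρ > 2(Φ⁰ − f_min)/δ² and K > (7/(4βξ) + 2K/(ρδ²))·(Φ⁰ − f_min). Suppose moreover 𝒴 ⊇ {Y ∈ S^n : ‖Y‖_F ≤ R̄_Y} with R_Y ≥ R̄_Y > (L + 2ρR_X + max{√r, √(λ⁻¹)}·√ξ)/(2√(1−δ)). Then the number of indices k ∈ {0, …, K} with Y^k ∈ int(𝒴) is at least K − (7/(4βξ) + 2K/(ρδ²))·(Φ⁰ − f_min). -/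

import Mathlib

open Matrix

noncomputable section

/-- Frobenius inner product `⟨A,B⟩ = tr(AᵀB)`. -/
def frobInner {m n : ℕ} (A B : Matrix (Fin m) (Fin n) ℝ) : ℝ := (Aᵀ * B).trace

/-- Frobenius norm. -/
def frobNorm {m n : ℕ} (A : Matrix (Fin m) (Fin n) ℝ) : ℝ := Real.sqrt (frobInner A A)

/-- Spectral (operator) norm of a matrix. -/
def specNorm {m n : ℕ} (A : Matrix (Fin m) (Fin n) ℝ) : ℝ :=
  ‖LinearMap.toContinuousLinearMap (Matrix.toEuclideanLin A)‖

/-- `G(X) := XᵀX − Iₙ`. -/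
def Gm {m n : ℕ} (X : Matrix (Fin m) (Fin n) ℝ) : Matrix (Fin n) (Fin n) ℝ := Xᵀ * X - 1

/-- `gradl` is the (Fréchet) gradient of `ℓ` w.r.t. the Frobenius inner product. -/
def IsGradientOf {m n : ℕ} (gradl : Matrix (Fin m) (Fin n) ℝ → Matrix (Fin m) (Fin n) ℝ)
    (ℓ : Matrix (Fin m) (Fin n) ℝ → ℝ) : Prop :=
  ∀ X : Matrix (Fin m) (Fin n) ℝ, ∀ c : ℝ, 0 < c → ∃ δ : ℝ, 0 < δ ∧
    ∀ H : Matrix (Fin m) (Fin n) ℝ, frobNorm H ≤ δ →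
      |ℓ (X + H) - ℓ X - frobInner (gradl X) H| ≤ c * frobNorm H

/-- Augmented Lagrangian `ℒ_ρ(X,Y) = f(X) + ⟨Y, G(X)⟩ + (ρ/2)‖G(X)‖_F²` with `f = ℓ + g`. -/
def Lag {m n : ℕ} (ℓ g : Matrix (Fin m) (Fin n) ℝ → ℝ) (ρ : ℝ)
    (X : Matrix (Fin m) (Fin n) ℝ) (Y : Matrix (Fin n) (Fin n) ℝ) : ℝ :=
  ℓ X + g X + frobInner Y (Gm X) + ρ / 2 * frobNorm (Gm X) ^ 2

/-- `F(X,Y,Z) = ℒ_ρ(X,Y) − (ε/2)‖Y‖_F² + (r/2)‖X−Z‖_F²`. -/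
def Ffun {m n : ℕ} (ℓ g : Matrix (Fin m) (Fin n) ℝ → ℝ) (ρ r ε : ℝ)
    (X : Matrix (Fin m) (Fin n) ℝ) (Y : Matrix (Fin n) (Fin n) ℝ)
    (Z : Matrix (Fin m) (Fin n) ℝ) : ℝ :=
  Lag ℓ g ρ X Y - ε / 2 * frobNorm Y ^ 2 + r / 2 * frobNorm (X - Z) ^ 2

/-- Dual function `d(Y,Z) = min_{X ∈ 𝒳} F(X,Y,Z)`. -/
def dfun {m n : ℕ} (𝒳 : Set (Matrix (Fin m) (Fin n) ℝ))
    (ℓ g : Matrix (Fin m) (Fin n) ℝ → ℝ) (ρ r ε : ℝ)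
    (Y : Matrix (Fin n) (Fin n) ℝ) (Z : Matrix (Fin m) (Fin n) ℝ) : ℝ :=
  sInf ((fun X => Ffun ℓ g ρ r ε X Y Z) '' 𝒳)

/-- Proximal function `p(Z) = max_{Y ∈ 𝒴} d(Y,Z)`. -/
def pfun {m n : ℕ} (𝒳 : Set (Matrix (Fin m) (Fin n) ℝ))
    (𝒴 : Set (Matrix (Fin n) (Fin n) ℝ))
    (ℓ g : Matrix (Fin m) (Fin n) ℝ → ℝ) (ρ r ε : ℝ)
    (Z : Matrix (Fin m) (Fin n) ℝ) : ℝ :=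
  sSup ((fun Y => dfun 𝒳 ℓ g ρ r ε Y Z) '' 𝒴)

/-- Potential function `Φ(X,Y,Z) = F(X,Y,Z) − 2d(Y,Z) + 2p(Z)`. -/
def Phi {m n : ℕ} (𝒳 : Set (Matrix (Fin m) (Fin n) ℝ))
    (𝒴 : Set (Matrix (Fin n) (Fin n) ℝ))
    (ℓ g : Matrix (Fin m) (Fin n) ℝ → ℝ) (ρ r ε : ℝ)
    (X : Matrix (Fin m) (Fin n) ℝ) (Y : Matrix (Fin n) (Fin n) ℝ)
    (Z : Matrix (Fin m) (Fin n) ℝ) : ℝ :=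
  Ffun ℓ g ρ r ε X Y Z - 2 * dfun 𝒳 ℓ g ρ r ε Y Z + 2 * pfun 𝒳 𝒴 ℓ g ρ r ε Z

/-- Linearized augmented Lagrangian `ℒ_{X̄,λ}(X,Y)`. -/
def LinLag {m n : ℕ} (ℓ g : Matrix (Fin m) (Fin n) ℝ → ℝ)
    (gradl : Matrix (Fin m) (Fin n) ℝ → Matrix (Fin m) (Fin n) ℝ) (ρ lam : ℝ)
    (Xb X : Matrix (Fin m) (Fin n) ℝ) (Y : Matrix (Fin n) (Fin n) ℝ) : ℝ :=
  ℓ Xb + frobInner Y (Gm Xb) + ρ / 2 * frobNorm (Gm Xb) ^ 2 + g X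
    + frobInner (gradl Xb) (X - Xb)
    + frobInner ((2 : ℝ) • (Xb * (Y + ρ • Gm Xb))) (X - Xb)
    + 1 / (2 * lam) * frobNorm (X - Xb) ^ 2

section Abstract

variable {E V : Type*} [NormedAddCommGroup E] [InnerProductSpace ℝ E]
  [NormedAddCommGroup V] [InnerProductSpace ℝ V]

open scoped RealInnerProductSpace

/-- A first-order inequality follows from its perturbations by second-order terms. -/
theorem le_of_small_perturbation {a b C t₀ : ℝ} (ht₀ : 0 < t₀)
    (h : ∀ t : ℝ, 0 < t → t ≤ t₀ → t * a ≤ t * b + t ^ 2 * C) : a ≤ b := by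
  by_contra hab
  push Not at hab
  have hC : 0 < |C| + 1 := by positivity
  set t := min t₀ ((a - b) / (2 * (|C| + 1))) with ht
  have htpos : 0 < t := lt_min ht₀ (div_pos (by linarith) (by positivity))
  have h1 := h t htpos (min_le_left _ _)
  have h2 : t * (2 * (|C| + 1)) ≤ a - b := by
    rw [← le_div_iff₀ (by positivity)]
    exact min_le_right _ _
  have h3 : a ≤ b + t * C := by
    have : t * a ≤ t * (b + t * C) := by nlinarith
    exact le_of_mul_le_mul_left this htpos
  nlinarith [le_abs_self C]

theorem quadratic_growth_of_isMin {S : Set E} (hS : Convex ℝ S) {h g : E → ℝ} {κ Lg : ℝ}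
    (hh : ∀ m ∈ S, ∃ v : E, ∀ u ∈ S, h m + ⟪v, u - m⟫ - κ / 2 * ‖u - m‖ ^ 2 ≤ h u)
    (hg : ConvexOn ℝ S (fun X => g X + Lg / 2 * ‖X‖ ^ 2))
    {x : E} (hx : x ∈ S) (hmin : ∀ u ∈ S, h x + g x ≤ h u + g u) {u : E} (hu : u ∈ S) :
    h x + g x + (-κ - Lg) / 2 * ‖u - x‖ ^ 2 ≤ h u + g u := by
  suffices H : (-κ - Lg) / 2 * ‖u - x‖ ^ 2 ≤ (h u + g u) - (h x + g x) by linarith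
  refine le_of_small_perturbation (C := (-κ - Lg) / 2 * ‖u - x‖ ^ 2) one_pos fun t ht0 ht1 => ?_
  have hm : (1 - t) • x + t • u ∈ S := hS hx hu (by linarith) ht0.le (by ring)
  have hgm := hg.2 hx hu (by linarith : 0 ≤ 1 - t) ht0.le (by ring)
  set m := (1 - t) • x + t • u with hmdef
  obtain ⟨v, hv⟩ := hh m hm
  have hvx := hv x hx
  have hvu := hv u hu
  have hPm := hmin m hm
  have e1 : x - m = (-t) • (u - x) := by rw [hmdef]; module
  have e2 : u - m = (1 - t) • (u - x) := by rw [hmdef]; module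
  have n1 : ‖x - m‖ ^ 2 = t ^ 2 * ‖u - x‖ ^ 2 := by
    rw [e1, norm_smul, mul_pow, Real.norm_eq_abs, sq_abs]; ring
  have n2 : ‖u - m‖ ^ 2 = (1 - t) ^ 2 * ‖u - x‖ ^ 2 := by
    rw [e2, norm_smul, mul_pow, Real.norm_eq_abs, sq_abs]
  have i1 : ⟪v, x - m⟫ = -t * ⟪v, u - x⟫ := by rw [e1, real_inner_smul_right]
  have i2 : ⟪v, u - m⟫ = (1 - t) * ⟪v, u - x⟫ := by rw [e2, real_inner_smul_right]
  have n3 : ‖m‖ ^ 2 = (1 - t) * ‖x‖ ^ 2 + t * ‖u‖ ^ 2 - t * (1 - t) * ‖u - x‖ ^ 2 := by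
    rw [hmdef]
    simp only [← real_inner_self_eq_norm_sq, inner_add_left, inner_add_right, inner_sub_left,
      inner_sub_right, real_inner_smul_left, real_inner_smul_right, real_inner_comm x u]
    ring
  rw [n1, i1] at hvx
  rw [n2, i2] at hvu
  simp only [smul_eq_mul] at hgm
  rw [n3] at hgm
  have a1 := mul_le_mul_of_nonneg_left hvx (by linarith : 0 ≤ 1 - t)
  have a2 := mul_le_mul_of_nonneg_left hvu ht0.le
  nlinarith

/-- The root bound for the quadratic inequality satisfied by the error of a proximal step. -/
theorem le_of_quadratic_error_bound {e D γ s L : ℝ} (hγ : 0 < γ) (hs : 0 < s)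
    (hL : 0 ≤ L) (hD : 0 ≤ D) (h : γ * e ^ 2 ≤ 2 * s * e * D + 2 * L * D ^ 2) :
    e ≤ (2 * s / γ + 1) * (Real.sqrt (2 * L / s) + 1) * D := by
  set q := Real.sqrt (2 * L / s) with hq
  have hq0 : 0 ≤ q := Real.sqrt_nonneg _
  have hq2 : q ^ 2 * s = 2 * L := by
    rw [hq, Real.sq_sqrt (by positivity)]; field_simp
  obtain ⟨k, hk⟩ : ∃ k, k = s / γ := ⟨_, rfl⟩
  have hk0 : 0 < k := hk ▸ div_pos hs hγ
  have hsk : s = k * γ := by rw [hk]; field_simp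
  have h1 : e ^ 2 ≤ 2 * k * e * D + k * q ^ 2 * D ^ 2 := by
    rw [← hq2, hsk] at h
    have : γ * e ^ 2 ≤ γ * (2 * k * e * D + k * q ^ 2 * D ^ 2) := by linarith
    exact le_of_mul_le_mul_left this hγ
  have h2 : (e - k * D) ^ 2 ≤ ((k + (2 * k + 1) * q) * D) ^ 2 := by
    have : k ^ 2 + k * q ^ 2 ≤ (k + (2 * k + 1) * q) ^ 2 := by
      nlinarith [mul_nonneg hk0.le hq0, mul_nonneg hk0.le (sq_nonneg q),
        mul_nonneg (sq_nonneg k) (sq_nonneg q), mul_nonneg (sq_nonneg k) hq0, sq_nonneg q]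
    nlinarith [mul_le_mul_of_nonneg_right this (sq_nonneg D)]
  have h3 := abs_le_of_sq_le_sq h2 (by positivity)
  have h4 := (abs_le.1 (abs_le_of_sq_le_sq h2 (by positivity))).2
  have : 2 * s / γ = 2 * k := by rw [hk]; ring
  rw [this]
  nlinarith

/-- Sufficient decrease and error bound for one proximal linearized step. -/
theorem prox_linear_step {S : Set E} (hS : Convex ℝ S) {h g : E → ℝ} {Lg L γ c r : ℝ}
    (hγ : 0 < γ) (hc : 0 < c) (hL : 0 ≤ L) (hr : L + Lg ≤ r)
    (hg : ConvexOn ℝ S (fun X => g X + Lg / 2 * ‖X‖ ^ 2))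
    {x v z xp xs : E} (hx : x ∈ S)
    (hmodel : ∀ u ∈ S, |h u - h x - ⟪v, u - x⟫| ≤ L / 2 * ‖u - x‖ ^ 2)
    (hxp : xp ∈ S)
    (hmin : ∀ u ∈ S, g xp + ⟪v, xp - x⟫ + c / 2 * ‖xp - x‖ ^ 2 + r / 2 * ‖xp - z‖ ^ 2
      ≤ g u + ⟪v, u - x⟫ + c / 2 * ‖u - x‖ ^ 2 + r / 2 * ‖u - z‖ ^ 2)
    (hxs : xs ∈ S)
    (hgrowth : ∀ u ∈ S, h xs + g xs + r / 2 * ‖xs - z‖ ^ 2 + γ / 2 * ‖u - xs‖ ^ 2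
      ≤ h u + g u + r / 2 * ‖u - z‖ ^ 2) :
    (2 * c + r - Lg - L) / 2 * ‖xp - x‖ ^ 2
        ≤ (h x + g x + r / 2 * ‖x - z‖ ^ 2) - (h xp + g xp + r / 2 * ‖xp - z‖ ^ 2) ∧
      ‖xp - xs‖ ≤ (2 * (c + L) / γ + 1) * (Real.sqrt (2 * L / (c + L)) + 1) * ‖xp - x‖ := by
  have grow : ∀ u ∈ S, g xp + ⟪v, xp - x⟫ + c / 2 * ‖xp - x‖ ^ 2 + r / 2 * ‖xp - z‖ ^ 2
      + (c + r - Lg) / 2 * ‖u - xp‖ ^ 2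
      ≤ g u + ⟪v, u - x⟫ + c / 2 * ‖u - x‖ ^ 2 + r / 2 * ‖u - z‖ ^ 2 := by
    intro u hu
    have := quadratic_growth_of_isMin hS
      (h := fun u => ⟪v, u - x⟫ + c / 2 * ‖u - x‖ ^ 2 + r / 2 * ‖u - z‖ ^ 2) (g := g)
      (κ := -(c + r)) (Lg := Lg) ?_ hg hxp (fun u hu => by have := hmin u hu; linarith) hu
    · linarith
    · intro m _
      refine ⟨v + c • (m - x) + r • (m - z), fun u _ => le_of_eq ?_⟩
      simp only [← real_inner_self_eq_norm_sq, inner_add_left, inner_sub_left,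
        inner_sub_right, real_inner_smul_left, real_inner_comm x u, real_inner_comm m u,
        real_inner_comm z u, real_inner_comm x m, real_inner_comm z m]
      ring
  have m1 := abs_le.1 (hmodel xp hxp)
  have m2 := abs_le.1 (hmodel xs hxs)
  have g1 := grow x hx
  have g2 := grow xs hxs
  have g3 := hgrowth xp hxp
  constructor
  · rw [norm_sub_rev x xp] at g1
    simp only [sub_self, norm_zero, inner_zero_right] at g1
    nlinarith
  · refine le_of_quadratic_error_bound hγ (by linarith) hL (norm_nonneg _) ?_
    rw [norm_sub_rev xs xp] at g2
    have tri : ‖xs - x‖ ≤ ‖xp - xs‖ + ‖xp - x‖ := by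
      calc ‖xs - x‖ = ‖(xp - x) - (xp - xs)‖ := by congr 1; abel
        _ ≤ _ := by rw [add_comm]; exact norm_sub_le _ _
    have tri2 : ‖xs - x‖ ^ 2 ≤ (‖xp - xs‖ + ‖xp - x‖) ^ 2 :=
      pow_le_pow_left₀ (norm_nonneg _) tri 2
    have t3 := mul_le_mul_of_nonneg_left tri2 (by linarith : 0 ≤ c + L)
    have t4 := mul_nonneg (by linarith : 0 ≤ r - Lg - L) (sq_nonneg ‖xp - xs‖)
    nlinarith

/-- The regularized Lagrangian `φ(x) + ⟨y, G(x)⟩ − (ε/2)‖y‖² + (r/2)‖x − z‖²`. -/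
noncomputable def regLag (φ : E → ℝ) (G : E → V) (ε r : ℝ) (x : E) (y : V) (z : E) : ℝ :=
  φ x + ⟪y, G x⟫ - ε / 2 * ‖y‖ ^ 2 + r / 2 * ‖x - z‖ ^ 2

/-- `xm y z` minimizes `regLag φ G ε r · y z` over `S`, with quadratic growth of modulus `γ`. -/
def HasGrowthMin (φ : E → ℝ) (G : E → V) (ε r γ : ℝ) (S : Set E) (T : Set V)
    (xm : V → E → E) : Prop :=
  ∀ y ∈ T, ∀ z, xm y z ∈ S ∧ ∀ u ∈ S,
    regLag φ G ε r (xm y z) y z + γ / 2 * ‖u - xm y z‖ ^ 2 ≤ regLag φ G ε r u y z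

section Regularized

variable {φ : E → ℝ} {G : E → V} {ε r γ R : ℝ} {S : Set E} {T : Set V} {xm : V → E → E}

set_option linter.unusedSectionVars false in
theorem HasGrowthMin.monotone_dual (H : HasGrowthMin φ G ε r γ S T xm) {y y' : V}
    (hy : y ∈ T) (hy' : y' ∈ T) (z : E) :
    γ * ‖xm y z - xm y' z‖ ^ 2 ≤ ⟪y - y', G (xm y' z) - G (xm y z)⟫ := by
  have h1 := (H y hy z).2 _ (H y' hy' z).1
  have h2 := (H y' hy' z).2 _ (H y hy z).1
  rw [norm_sub_rev] at h1
  simp only [regLag] at h1 h2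
  simp only [inner_sub_left, inner_sub_right]
  linarith

theorem HasGrowthMin.lipschitz_dual (H : HasGrowthMin φ G ε r γ S T xm) (hγ : 0 < γ)
    (hR : 0 ≤ R) (hG : ∀ a ∈ S, ∀ b ∈ S, ‖G a - G b‖ ≤ 2 * R * ‖a - b‖)
    {y y' : V} (hy : y ∈ T) (hy' : y' ∈ T) (z : E) :
    ‖xm y z - xm y' z‖ ≤ 2 * R / γ * ‖y - y'‖ := by
  have h := H.monotone_dual hy hy' z
  have h2 := (real_inner_le_norm (y - y') (G (xm y' z) - G (xm y z))).trans
    (mul_le_mul_of_nonneg_left (hG _ (H y' hy' z).1 _ (H y hy z).1) (norm_nonneg _))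
  rw [norm_sub_rev (xm y' z)] at h2
  by_contra hlt
  push Not at hlt
  have h3 : 2 * R * ‖y - y'‖ < γ * ‖xm y z - xm y' z‖ := by
    rw [div_mul_eq_mul_div, div_lt_iff₀ hγ] at hlt; linarith
  have h4 : 0 < ‖xm y z - xm y' z‖ := lt_of_le_of_lt (by positivity) hlt
  nlinarith [mul_lt_mul_of_pos_right h3 h4]

theorem HasGrowthMin.lipschitz_prox (H : HasGrowthMin φ G ε r γ S T xm) (hγ : 0 < γ)
    (hr : 0 ≤ r) {y : V} (hy : y ∈ T) (z z' : E) :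
    ‖xm y z - xm y z'‖ ≤ r / γ * ‖z - z'‖ := by
  have h1 := (H y hy z).2 _ (H y hy z').1
  have h2 := (H y hy z').2 _ (H y hy z).1
  rw [norm_sub_rev] at h1
  simp only [regLag] at h1 h2
  have h3 : γ * ‖xm y z - xm y z'‖ ^ 2 ≤ r * ⟪xm y z - xm y z', z - z'⟫ := by
    have e : ‖xm y z' - z‖ ^ 2 - ‖xm y z - z‖ ^ 2 + ‖xm y z - z'‖ ^ 2 - ‖xm y z' - z'‖ ^ 2
        = 2 * ⟪xm y z - xm y z', z - z'⟫ := by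
      simp only [norm_sub_sq_real, inner_sub_left, inner_sub_right]
      ring
    linear_combination h1 + h2 + r / 2 * e
  have h4 := mul_le_mul_of_nonneg_left (real_inner_le_norm (xm y z - xm y z') (z - z')) hr
  by_contra hlt
  push Not at hlt
  have h5 : r * ‖z - z'‖ < γ * ‖xm y z - xm y z'‖ := by
    rw [div_mul_eq_mul_div, div_lt_iff₀ hγ] at hlt; linarith
  have h6 : 0 < ‖xm y z - xm y z'‖ := lt_of_le_of_lt (by positivity) hlt
  nlinarith [mul_lt_mul_of_pos_right h5 h6]

/-- First-order optimality of a maximizer of the dual function. -/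
theorem HasGrowthMin.dual_optimality (H : HasGrowthMin φ G ε r γ S T xm) (hγ : 0 < γ)
    (hR : 0 ≤ R) (hG : ∀ a ∈ S, ∀ b ∈ S, ‖G a - G b‖ ≤ 2 * R * ‖a - b‖)
    (hT : Convex ℝ T) {z : E} {ys : V} (hys : ys ∈ T)
    (hmax : ∀ y ∈ T, regLag φ G ε r (xm y z) y z ≤ regLag φ G ε r (xm ys z) ys z)
    {y : V} (hy : y ∈ T) : ⟪G (xm ys z) - ε • ys, y - ys⟫ ≤ 0 := by
  refine le_of_small_perturbation (C := (4 * R ^ 2 / γ + ε / 2) * ‖y - ys‖ ^ 2) one_pos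
    fun t ht0 ht1 => ?_
  have hyt : (1 - t) • ys + t • y ∈ T := hT hys hy (by linarith) ht0.le (by ring)
  set yt := (1 - t) • ys + t • y with hytdef
  have e1 : yt = ys + t • (y - ys) := by rw [hytdef]; module
  have e2 : yt - ys = t • (y - ys) := by rw [e1]; abel
  have h1 := hmax yt hyt
  have h2 := (H ys hys z).2 _ (H yt hyt z).1
  have h3 : 0 ≤ γ / 2 * ‖xm yt z - xm ys z‖ ^ 2 := by positivity
  have h4 : regLag φ G ε r (xm yt z) yt z - regLag φ G ε r (xm yt z) ys z ≤ 0 := by linarith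
  have n1 : ‖yt‖ ^ 2 = ‖ys‖ ^ 2 + 2 * t * ⟪ys, y - ys⟫ + t ^ 2 * ‖y - ys‖ ^ 2 := by
    rw [e1, norm_add_sq_real, real_inner_smul_right, norm_smul, mul_pow, Real.norm_eq_abs, sq_abs]
    ring
  have i1 : ⟪yt, G (xm yt z)⟫ = ⟪ys, G (xm yt z)⟫ + t * ⟪y - ys, G (xm yt z)⟫ := by
    rw [e1, inner_add_left, real_inner_smul_left]
  have h5 : t * ⟪y - ys, G (xm yt z)⟫
      ≤ ε / 2 * (2 * t * ⟪ys, y - ys⟫ + t ^ 2 * ‖y - ys‖ ^ 2) := by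
    simp only [regLag] at h4
    rw [n1, i1] at h4
    linarith
  have l1 := H.lipschitz_dual hγ hR hG hyt hys z
  rw [e2, norm_smul, Real.norm_eq_abs, abs_of_pos ht0] at l1
  have l2 : ‖G (xm ys z) - G (xm yt z)‖ ≤ 2 * R * (2 * R / γ * (t * ‖y - ys‖)) := by
    refine (hG _ (H ys hys z).1 _ (H yt hyt z).1).trans ?_
    rw [norm_sub_rev]
    exact mul_le_mul_of_nonneg_left l1 (by positivity)
  have l3 := (real_inner_le_norm (G (xm ys z) - G (xm yt z)) (y - ys)).trans
    (mul_le_mul_of_nonneg_right l2 (norm_nonneg _))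
  have l4 := mul_le_mul_of_nonneg_left l3 ht0.le
  have e3 : t * (2 * R * (2 * R / γ * (t * ‖y - ys‖)) * ‖y - ys‖)
      = t ^ 2 * (4 * R ^ 2 / γ * ‖y - ys‖ ^ 2) := by ring
  rw [e3] at l4
  rw [inner_sub_left, real_inner_smul_left]
  rw [inner_sub_left, real_inner_comm (y - ys) (G (xm yt z))] at l4
  linarith

/-- Dual error bound: a projected dual step that is nearly stationary has a primal response
close to the optimal one. -/
theorem HasGrowthMin.dual_error_bound (H : HasGrowthMin φ G ε r γ S T xm) (hγ : 0 < γ)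
    (hε : 0 < ε) {α : ℝ}
    (hR : 0 ≤ R) (hG : ∀ a ∈ S, ∀ b ∈ S, ‖G a - G b‖ ≤ 2 * R * ‖a - b‖)
    (hT : Convex ℝ T) {z : E} {ys : V} (hys : ys ∈ T)
    (hmax : ∀ y ∈ T, regLag φ G ε r (xm y z) y z ≤ regLag φ G ε r (xm ys z) ys z)
    {y yp w : V} (hyp : yp ∈ T) (hα : 0 < α)
    (hproj : ⟪y + α • w - yp, ys - yp⟫ ≤ 0) {A : ℝ}
    (hA : ‖G (xm yp z) - ε • yp - w‖ + ‖yp - y‖ / α ≤ A) :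
    2 * Real.sqrt γ * Real.sqrt ε * ‖xm yp z - xm ys z‖ ≤ A := by
  have h1 := H.dual_optimality hγ hR hG hT hys hmax hyp
  have h2 := H.monotone_dual hyp hys z
  have h3 : ⟪w, ys - yp⟫ ≤ ‖yp - y‖ / α * ‖yp - ys‖ := by
    have e : y + α • w - yp = α • w - (yp - y) := by abel
    rw [e, inner_sub_left, real_inner_smul_left] at hproj
    have := real_inner_le_norm (yp - y) (ys - yp)
    rw [norm_sub_rev ys yp] at this
    rw [div_mul_eq_mul_div, le_div_iff₀ hα]
    linarith
  have h4 := real_inner_le_norm (G (xm yp z) - ε • yp - w) (ys - yp)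
  rw [norm_sub_rev ys yp] at h4
  have h5 : ε * ‖yp - ys‖ ^ 2 + γ * ‖xm yp z - xm ys z‖ ^ 2 ≤ A * ‖yp - ys‖ := by
    have h6 := mul_le_mul_of_nonneg_right hA (norm_nonneg (yp - ys))
    simp only [← real_inner_self_eq_norm_sq (yp - ys), inner_sub_left, inner_sub_right,
      real_inner_smul_left, real_inner_comm ys yp] at *
    simp only [real_inner_comm (G (xm ys z)) _, real_inner_comm (G (xm yp z)) _] at *
    nlinarith
  have hA0 : 0 ≤ A := le_trans (by positivity) hA
  refine (sq_le_sq₀ (by positivity) hA0).1 ?_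
  have h7 : 0 ≤ (A - 2 * ε * ‖yp - ys‖) ^ 2 := sq_nonneg _
  have h8 : (2 * Real.sqrt γ * Real.sqrt ε * ‖xm yp z - xm ys z‖) ^ 2
      = 4 * γ * ε * ‖xm yp z - xm ys z‖ ^ 2 := by
    rw [mul_pow, mul_pow, mul_pow, Real.sq_sqrt hγ.le, Real.sq_sqrt hε.le]; ring
  rw [h8]
  nlinarith [mul_le_mul_of_nonneg_left h5 hε.le]


end Regularized

set_option maxHeartbeats 1000000 in
/-- The scalar inequality behind the descent of the potential. -/
theorem descent_scalar {α β R r γ c ζ σ₂ ω ε Δ D b e xe P : ℝ}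
    (hα : 0 < α) (hβ : 0 < β) (hR : 0 < R) (hr : 0 < r) (hγ : 0 < γ) (hε : 0 < ε)
    (hΔ : 0 ≤ Δ) (hD : 0 ≤ D) (hb : 0 ≤ b)
    (hζ : 0 < ζ) (hσ₂ : σ₂ = 2 * R / γ)
    (hω : ω = (1 / Real.sqrt γ) * ((1 + (2 * σ₂ * R + ε) * α) / (Real.sqrt ε * α)))
    (hγr : 2 * r ≤ 3 * γ) (hγR : 4 * R ≤ γ) (hrR : 4 * R ≤ r) (hcR : 2 * R ≤ c)
    (hα1 : α * (20 * R) ≤ 1) (hα2 : α * (8 * R * ζ ^ 2) ≤ 1)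
    (hβ1 : β ≤ 1 / 28) (hβ2 : β * (448 * (r * ω ^ 2 * α)) ≤ 1)
    (he : e ≤ ζ * Δ)
    (hxe : 2 * Real.sqrt γ * Real.sqrt ε * xe
      ≤ (1 / α + ε + 2 * R * σ₂) * D + 2 * R * (e + r / γ * (β * b)))
    (hP : (c + r / 3) * Δ ^ 2 + (D ^ 2 / (2 * α) - 4 * R * (σ₂ * D + e) * D)
      + (r * β * (1 - β / 2) * b ^ 2 - 2 * r * β * b * (xe + r / γ * (β * b))) ≤ P) :
    (c / 2 + r / 5) * Δ ^ 2 + 4 / 5 * (r * β * b ^ 2) ≤ P := by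
  have hsγ : 0 < Real.sqrt γ := Real.sqrt_pos.2 hγ
  have hsε : 0 < Real.sqrt ε := Real.sqrt_pos.2 hε
  have hσ₂0 : 0 < σ₂ := hσ₂ ▸ by positivity
  have hω0 : 0 < ω := hω ▸ by positivity
  obtain ⟨σ, hσ⟩ : ∃ σ, σ = r / γ := ⟨_, rfl⟩
  rw [← hσ] at hxe hP
  have hσ0 : 0 < σ := hσ ▸ by positivity
  have hσ1 : σ ≤ 3 / 2 := by rw [hσ, div_le_iff₀ hγ]; linarith
  -- the primal error in terms of the three residuals
  have hωeq : Real.sqrt γ * Real.sqrt ε * ω = 1 / α + ε + 2 * R * σ₂ := by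
    rw [hω]; field_simp; ring
  have hωge : 1 ≤ Real.sqrt γ * Real.sqrt ε * (α * ω) := by
    have : Real.sqrt γ * Real.sqrt ε * (α * ω) = α * (1 / α + ε + 2 * R * σ₂) := by
      rw [← hωeq]; ring
    rw [this]
    have h1 : α * (1 / α + ε + 2 * R * σ₂) = 1 + α * (ε + 2 * R * σ₂) := by
      field_simp; ring
    rw [h1]
    have : 0 ≤ α * (ε + 2 * R * σ₂) := by positivity
    linarith
  have hxe' : xe ≤ ω * D / 2 + α * ω * R * (ζ * Δ) + α * ω * R * (σ * (β * b)) := by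
    have hs : 0 < Real.sqrt γ * Real.sqrt ε := by positivity
    have h0 : 0 ≤ 2 * R * (ζ * Δ + σ * (β * b)) := by positivity
    have h1 : 2 * R * (e + σ * (β * b)) ≤ 2 * R * (ζ * Δ + σ * (β * b)) :=
      mul_le_mul_of_nonneg_left (by linarith) (by positivity)
    have h2 := mul_le_mul_of_nonneg_right hωge h0
    rw [← hωeq] at hxe
    refine le_of_mul_le_mul_left ?_ hs
    linarith
  have hDα : 0 ≤ D ^ 2 / α := by positivity
  -- the term from Lipschitz continuity of the primal response
  have T1 : 4 * R * σ₂ * D ^ 2 ≤ D ^ 2 / α / 10 := by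
    have : 4 * R * σ₂ ≤ 1 / α / 10 := by
      rw [hσ₂, div_div, le_div_iff₀ (by positivity)]
      have : 4 * R * (2 * R / γ) * (α * 10) = 4 * (α * (20 * R)) * R / γ := by ring
      rw [this, div_le_one hγ]
      nlinarith
    calc 4 * R * σ₂ * D ^ 2 ≤ 1 / α / 10 * D ^ 2 := mul_le_mul_of_nonneg_right this (sq_nonneg _)
      _ = _ := by ring
  have T2 : 4 * R * e * D ≤ D ^ 2 / α / 3 + 3 / 2 * R * Δ ^ 2 := by
    have h1 : 4 * R * e * D ≤ 4 * R * (ζ * Δ) * D := by gcongr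
    have h2 : 4 * R * (ζ * Δ) * D ≤ D ^ 2 / α / 3 + 12 * α * (R * (ζ * Δ)) ^ 2 := by
      have h3 : D ^ 2 / α / 3 + 12 * α * (R * (ζ * Δ)) ^ 2 - 4 * R * (ζ * Δ) * D
          = (D - 6 * α * (R * (ζ * Δ))) ^ 2 / α / 3 := by field_simp; ring
      have h4 : 0 ≤ (D - 6 * α * (R * (ζ * Δ))) ^ 2 / α / 3 := by positivity
      linarith
    have h5 : 12 * α * (R * (ζ * Δ)) ^ 2 ≤ 3 / 2 * R * Δ ^ 2 := by
      have h6 := mul_le_mul_of_nonneg_right hα2 (by positivity : 0 ≤ 3 / 2 * R * Δ ^ 2)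
      linarith
    linarith
  have hrβ : 0 < r * β := by positivity
  have T3 : 2 * r * β * b * (ω * D / 2) ≤ r * β * b ^ 2 / 50 + D ^ 2 / α / 30 := by
    have h1 : 2 * r * β * b * (ω * D / 2) ≤ r * β * b ^ 2 / 50 + 25 / 2 * (r * β) * (ω * D) ^ 2 := by
      linarith [mul_nonneg hrβ.le (sq_nonneg (b - 25 * (ω * D)))]
    have h2 : 25 / 2 * (r * β) * (ω * D) ^ 2 ≤ D ^ 2 / α / 30 := by
      have h3 := mul_le_mul_of_nonneg_right hβ2 hDα
      have h4 : β * (448 * (r * ω ^ 2 * α)) * (D ^ 2 / α) = 448 * (r * β * (ω * D) ^ 2) := by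
        field_simp
      have h5 : 0 ≤ r * β * (ω * D) ^ 2 := by positivity
      linarith
    linarith
  have T4 : 2 * r * β * b * (α * ω * R * (ζ * Δ)) ≤ r * β * b ^ 2 / 50 + R * Δ ^ 2 / 50 := by
    have h1 : 2 * r * β * b * (α * ω * R * (ζ * Δ))
        ≤ r * β * b ^ 2 / 50 + 50 * (r * β) * (α * ω * R * (ζ * Δ)) ^ 2 := by
      linarith [mul_nonneg hrβ.le (sq_nonneg (b - 50 * (α * ω * R * (ζ * Δ))))]
    have h2 : 50 * (r * β) * (α * ω * R * (ζ * Δ)) ^ 2 ≤ R * Δ ^ 2 / 50 := by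
      have h3 := mul_le_mul_of_nonneg_right hβ2 (by positivity : 0 ≤ α * (R * (ζ * Δ)) ^ 2)
      have h6 := mul_le_mul_of_nonneg_right hα2 (by positivity : 0 ≤ R * Δ ^ 2)
      have h7 : 0 ≤ R * Δ ^ 2 := by positivity
      linarith
    linarith
  have T5 : 2 * r * β * b * (α * ω * R * (σ * (β * b))) ≤ r * β * b ^ 2 / 50 := by
    have h1 : α * ω * R * β ≤ 1 / 300 := by
      refine (sq_le_sq₀ (by positivity) (by norm_num)).1 ?_
      have h2 : (α * ω * R * β) ^ 2 * r ≤ 1 / 90000 * r := by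
        have h3 := mul_le_mul_of_nonneg_right hβ2 (by positivity : 0 ≤ α * R ^ 2 * β)
        have h4 : α * R ^ 2 * β ≤ r / 2240 := by
          have h5 : α * (20 * R) * R * β ≤ 1 * R * (1 / 28) := by gcongr
          linarith
        linarith
      have := le_of_mul_le_mul_right h2 hr
      linarith
    have h2 : α * ω * R * β * σ ≤ 1 / 300 * (3 / 2) := by gcongr
    have h3 := mul_le_mul_of_nonneg_left h2 (by positivity : 0 ≤ 2 * (r * β * b ^ 2))
    have h4 : 0 ≤ r * β * b ^ 2 := by positivity
    linarith
  have T6 : 2 * r * β * b * (σ * (β * b)) ≤ r * β * b ^ 2 * (3 / 28) := by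
    have h2 : σ * β ≤ 3 / 2 * (1 / 28) := by gcongr
    have h3 := mul_le_mul_of_nonneg_left h2 (by positivity : 0 ≤ 2 * (r * β * b ^ 2))
    linarith
  have T7 : r * β * b ^ 2 * (β / 2) ≤ r * β * b ^ 2 * (1 / 56) := by
    exact mul_le_mul_of_nonneg_left (by linarith) (by positivity)
  have hxe2 := mul_le_mul_of_nonneg_left hxe' (by positivity : 0 ≤ 2 * r * β * b)
  have T8 : R * Δ ^ 2 ≤ c / 2 * Δ ^ 2 := by gcongr; linarith
  have T9 : R * Δ ^ 2 ≤ r / 4 * Δ ^ 2 := by gcongr; linarith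
  have h0 : 0 ≤ r * β * b ^ 2 := by positivity
  have h00 : 0 ≤ r * Δ ^ 2 := by positivity
  have hDD : D ^ 2 / (2 * α) = D ^ 2 / α / 2 := by field_simp
  rw [hDD] at hP
  linarith

theorem HasGrowthMin.potential_descent {φ : E → ℝ} {G : E → V} {ε r γ R : ℝ} {S : Set E}
    {T : Set V} {xm : V → E → E} (H : HasGrowthMin φ G ε r γ S T xm)
    {α β c ζ σ₂ ω : ℝ}
    (hα : 0 < α) (hβ : 0 < β) (hR : 0 < R) (hr : 0 < r) (hγ : 0 < γ) (hε : 0 < ε)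
    (hζ : 0 < ζ) (hσ₂ : σ₂ = 2 * R / γ)
    (hω : ω = (1 / Real.sqrt γ) * ((1 + (2 * σ₂ * R + ε) * α) / (Real.sqrt ε * α)))
    (hγr : 2 * r ≤ 3 * γ) (hγR : 4 * R ≤ γ) (hrR : 4 * R ≤ r) (hcR : 2 * R ≤ c)
    (hα1 : α * (20 * R) ≤ 1) (hα2 : α * (8 * R * ζ ^ 2) ≤ 1) (hα3 : α * ε ≤ 1)
    (hβ1 : β ≤ 1 / 28) (hβ2 : β * (448 * (r * ω ^ 2 * α)) ≤ 1)
    (hG : ∀ a ∈ S, ∀ b ∈ S, ‖G a - G b‖ ≤ 2 * R * ‖a - b‖)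
    (hT : Convex ℝ T) {x xp z zp : E} {y yp ys : V} (hxp : xp ∈ S)
    (hy : y ∈ T) (hyp : yp ∈ T) (hys : ys ∈ T)
    (hz : zp = z + β • (xp - z))
    (hproj : ∀ u ∈ T, ⟪y + α • (G xp - ε • y) - yp, u - yp⟫ ≤ 0)
    (hmax : ∀ u ∈ T, regLag φ G ε r (xm u zp) u zp ≤ regLag φ G ε r (xm ys zp) ys zp)
    (hdec : (c + r / 3) * ‖xp - x‖ ^ 2 ≤ regLag φ G ε r x y z - regLag φ G ε r xp y z)
    (herr : ‖xp - xm y z‖ ≤ ζ * ‖xp - x‖) {p pp : ℝ}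
    (hp : regLag φ G ε r (xm ys z) ys z ≤ p)
    (hpp : pp = regLag φ G ε r (xm ys zp) ys zp) :
    (c / 2 + r / 5) * ‖xp - x‖ ^ 2 + 4 / 5 * (r * β * ‖xp - z‖ ^ 2)
      ≤ (regLag φ G ε r x y z - 2 * regLag φ G ε r (xm y z) y z + 2 * p)
        - (regLag φ G ε r xp yp zp - 2 * regLag φ G ε r (xm yp zp) yp zp + 2 * pp) := by
  have hzz : ‖z - zp‖ = β * ‖xp - z‖ := by
    have : z - zp = -(β • (xp - z)) := by rw [hz]; abel
    rw [this, norm_neg, norm_smul, Real.norm_eq_abs, abs_of_pos hβ]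
  have hxz : ‖xp - zp‖ ^ 2 = (1 - β) ^ 2 * ‖xp - z‖ ^ 2 := by
    have : xp - zp = (1 - β) • (xp - z) := by rw [hz]; module
    rw [this, norm_smul, mul_pow, Real.norm_eq_abs, sq_abs]
  have hlip : ‖xm yp z - xm y z‖ ≤ σ₂ * ‖yp - y‖ := by
    rw [hσ₂]; exact H.lipschitz_dual hγ hR.le hG hyp hy z
  have hxpx : ‖xm yp z - xp‖ ≤ σ₂ * ‖yp - y‖ + ‖xp - xm y z‖ := by
    have : xm yp z - xp = (xm yp z - xm y z) - (xp - xm y z) := by abel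
    rw [this]
    exact (norm_sub_le _ _).trans (by linarith)
  have hlz : ‖xm yp zp - xm yp z‖ ≤ r / γ * (β * ‖xp - z‖) := by
    rw [← hzz, norm_sub_rev z zp]; exact H.lipschitz_prox hγ hr.le hyp zp z
  have hlz' : ‖xm ys zp - xm ys z‖ ≤ r / γ * (β * ‖xp - z‖) := by
    rw [← hzz, norm_sub_rev z zp]; exact H.lipschitz_prox hγ hr.le hys zp z
  refine descent_scalar (Δ := ‖xp - x‖) (D := ‖yp - y‖) (b := ‖xp - z‖) (e := ‖xp - xm y z‖)
    (xe := ‖xm yp zp - xm ys zp‖) hα hβ hR hr hγ hε (norm_nonneg _) (norm_nonneg _)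
    (norm_nonneg _) hζ hσ₂ hω hγr hγR hrR hcR hα1 hα2 hβ1 hβ2 herr ?_ ?_
  · refine H.dual_error_bound hγ hε hR.le hG hT hys hmax hyp hα (hproj ys hys) ?_
    have h1 : G (xm yp zp) - ε • yp - (G xp - ε • y)
        = (G (xm yp zp) - G xp) - ε • (yp - y) := by module
    have h2 : ‖xm yp zp - xp‖ ≤ σ₂ * ‖yp - y‖ + ‖xp - xm y z‖ + r / γ * (β * ‖xp - z‖) := by
      have : xm yp zp - xp = (xm yp zp - xm yp z) + (xm yp z - xp) := by abel
      rw [this]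
      exact (norm_add_le _ _).trans (by linarith)
    have h3 := hG _ (H yp hyp zp).1 _ hxp
    have h4 : ‖G (xm yp zp) - ε • yp - (G xp - ε • y)‖
        ≤ 2 * R * (σ₂ * ‖yp - y‖ + ‖xp - xm y z‖ + r / γ * (β * ‖xp - z‖)) + ε * ‖yp - y‖ := by
      rw [h1]
      refine (norm_sub_le _ _).trans ?_
      rw [norm_smul, Real.norm_eq_abs, abs_of_pos hε]
      have := mul_le_mul_of_nonneg_left h2 (by positivity : 0 ≤ 2 * R)
      linarith
    have h5 : ‖yp - y‖ / α = 1 / α * ‖yp - y‖ := by ring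
    rw [h5]
    linarith
  · -- dual ascent part
    have d1 : ‖yp - y‖ ^ 2 / α ≤ ⟪G xp - ε • y, yp - y⟫ := by
      have := hproj y hy
      have e : y + α • (G xp - ε • y) - yp = α • (G xp - ε • y) - (yp - y) := by abel
      rw [e, ← neg_sub yp y, inner_neg_right, inner_sub_left, real_inner_smul_left,
        real_inner_self_eq_norm_sq] at this
      rw [div_le_iff₀ hα]
      linarith
    have hsq : ‖yp‖ ^ 2 = ‖y‖ ^ 2 + 2 * ⟪y, yp - y⟫ + ‖yp - y‖ ^ 2 := by
      rw [← norm_add_sq_real]; congr 2; abel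
    have d2 : regLag φ G ε r xp yp z - regLag φ G ε r xp y z
        = ⟪G xp - ε • y, yp - y⟫ - ε / 2 * ‖yp - y‖ ^ 2 := by
      simp only [regLag, hsq]
      simp only [inner_sub_left, inner_sub_right, real_inner_smul_left, real_inner_comm _ (G xp)]
      ring
    have d3 : regLag φ G ε r (xm y z) y z ≤ regLag φ G ε r (xm yp z) y z :=
      le_trans (by have : 0 ≤ γ / 2 * ‖xm yp z - xm y z‖ ^ 2 := by positivity
                   linarith) ((H y hy z).2 _ (H yp hyp z).1)
    have d4 : regLag φ G ε r (xm yp z) yp z - regLag φ G ε r (xm yp z) y z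
        = ⟪G (xm yp z) - G xp, yp - y⟫ + ⟪G xp - ε • y, yp - y⟫ - ε / 2 * ‖yp - y‖ ^ 2 := by
      simp only [regLag, hsq]
      simp only [inner_sub_left, inner_sub_right, real_inner_smul_left,
        real_inner_comm _ (G (xm yp z)), real_inner_comm _ (G xp)]
      ring
    have d5 : -⟪G (xm yp z) - G xp, yp - y⟫
        ≤ 2 * R * (σ₂ * ‖yp - y‖ + ‖xp - xm y z‖) * ‖yp - y‖ := by
      refine (neg_le_abs _).trans ((abs_real_inner_le_norm _ _).trans ?_)
      refine mul_le_mul_of_nonneg_right ?_ (norm_nonneg _)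
      exact (hG _ (H yp hyp z).1 _ hxp).trans
        (mul_le_mul_of_nonneg_left hxpx (by positivity))
    have d6 : ε / 2 * ‖yp - y‖ ^ 2 ≤ ‖yp - y‖ ^ 2 / (2 * α) := by
      rw [le_div_iff₀ (by positivity)]
      nlinarith [mul_le_mul_of_nonneg_right hα3 (sq_nonneg ‖yp - y‖)]
    have d7 : ‖yp - y‖ ^ 2 / α = 2 * (‖yp - y‖ ^ 2 / (2 * α)) := by field_simp
    -- proximal center part
    have z1 : regLag φ G ε r xp yp z - regLag φ G ε r xp yp zp
        = r * β * (1 - β / 2) * ‖xp - z‖ ^ 2 := by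
      simp only [regLag, hxz]; ring
    have z2 : regLag φ G ε r (xm yp z) yp z ≤ regLag φ G ε r (xm yp zp) yp z :=
      le_trans (by have : 0 ≤ γ / 2 * ‖xm yp zp - xm yp z‖ ^ 2 := by positivity
                   linarith) ((H yp hyp z).2 _ (H yp hyp zp).1)
    have z3 : regLag φ G ε r (xm ys zp) ys zp ≤ regLag φ G ε r (xm ys z) ys zp :=
      le_trans (by have : 0 ≤ γ / 2 * ‖xm ys z - xm ys zp‖ ^ 2 := by positivity
                   linarith) ((H ys hys zp).2 _ (H ys hys z).1)
    have z4 : ∀ a b : E, ∀ u v : V,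
        (regLag φ G ε r a u zp - regLag φ G ε r a u z)
          - (regLag φ G ε r b v zp - regLag φ G ε r b v z) = r * ⟪a - b, z - zp⟫ := by
      intro a b u v
      simp only [regLag, norm_sub_sq_real, inner_sub_left, inner_sub_right]
      ring
    have z5 := z4 (xm ys z) (xm yp zp) ys yp
    have z6 : ‖xm ys z - xm yp zp‖
        ≤ ‖xm yp zp - xm ys zp‖ + r / γ * (β * ‖xp - z‖) := by
      have : xm ys z - xm yp zp = -(xm yp zp - xm ys zp) - (xm ys zp - xm ys z) := by abel
      rw [this]
      refine (norm_sub_le _ _).trans ?_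
      rw [norm_neg]; linarith
    have z7 : r * ⟪xm ys z - xm yp zp, z - zp⟫
        ≤ r * ((‖xm yp zp - xm ys zp‖ + r / γ * (β * ‖xp - z‖)) * (β * ‖xp - z‖)) := by
      refine mul_le_mul_of_nonneg_left ((real_inner_le_norm _ _).trans ?_) hr.le
      rw [hzz]
      exact mul_le_mul_of_nonneg_right z6 (by positivity)
    rw [hpp]
    linarith

theorem norm_le_of_inner_le {w : E} {L : ℝ} (hL : 0 ≤ L) (h : ∀ H : E, ⟪w, H⟫ ≤ L * ‖H‖) :
    ‖w‖ ≤ L := by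
  have h1 := h w
  rw [real_inner_self_eq_norm_sq] at h1
  by_contra hlt
  push Not at hlt
  nlinarith

/-- At a point from which all directions are feasible, the gradient of a Lipschitz function
is bounded by the Lipschitz constant. -/
theorem norm_gradient_le_of_lipschitz {S : Set E} {ℓ : E → ℝ} {x w : E} {L C : ℝ} (hL : 0 ≤ L)
    (hint : ∀ H : E, ∃ t₀ : ℝ, 0 < t₀ ∧ ∀ t, 0 < t → t ≤ t₀ → x + t • H ∈ S)
    (hlip : ∀ u ∈ S, |ℓ u - ℓ x| ≤ L * ‖u - x‖)
    (hmodel : ∀ u ∈ S, |ℓ u - ℓ x - ⟪w, u - x⟫| ≤ C * ‖u - x‖ ^ 2) : ‖w‖ ≤ L := by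
  refine norm_le_of_inner_le hL fun H => ?_
  obtain ⟨t₀, ht₀, ht⟩ := hint H
  refine le_of_small_perturbation (C := C * ‖H‖ ^ 2) ht₀ fun t h0 h1 => ?_
  have h2 := (abs_le.1 (hlip _ (ht t h0 h1))).2
  have h3 := (abs_le.1 (hmodel _ (ht t h0 h1))).1
  rw [add_sub_cancel_left, norm_smul, Real.norm_eq_abs, abs_of_pos h0] at h2 h3
  rw [real_inner_smul_right] at h3
  linarith

/-- Stationarity of the proximal linearized step at an interior minimizer. -/
theorem norm_prox_stationarity_le {S : Set E} {g : E → ℝ} {x v z xp : E} {Lg c r : ℝ}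
    (hLg : 0 ≤ Lg)
    (hint : ∀ H : E, ∃ t₀ : ℝ, 0 < t₀ ∧ ∀ t, 0 < t → t ≤ t₀ → xp + t • H ∈ S)
    (hlip : ∀ u ∈ S, |g u - g xp| ≤ Lg * ‖u - xp‖)
    (hmin : ∀ u ∈ S, g xp + ⟪v, xp - x⟫ + c / 2 * ‖xp - x‖ ^ 2 + r / 2 * ‖xp - z‖ ^ 2
      ≤ g u + ⟪v, u - x⟫ + c / 2 * ‖u - x‖ ^ 2 + r / 2 * ‖u - z‖ ^ 2) :
    ‖v + c • (xp - x) + r • (xp - z)‖ ≤ Lg := by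
  rw [← norm_neg]
  refine norm_le_of_inner_le hLg fun H => ?_
  obtain ⟨t₀, ht₀, ht⟩ := hint H
  refine le_of_small_perturbation (C := (c + r) / 2 * ‖H‖ ^ 2) ht₀ fun t h0 h1 => ?_
  have h2 := (abs_le.1 (hlip _ (ht t h0 h1))).2
  have h3 := hmin _ (ht t h0 h1)
  rw [add_sub_cancel_left, norm_smul, Real.norm_eq_abs, abs_of_pos h0] at h2
  have e : ∀ w : E, ‖xp + t • H - w‖ ^ 2
      = ‖xp - w‖ ^ 2 + 2 * t * ⟪xp - w, H⟫ + t ^ 2 * ‖H‖ ^ 2 := by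
    intro w
    rw [add_sub_right_comm, norm_add_sq_real, real_inner_smul_right, norm_smul, mul_pow,
      Real.norm_eq_abs, sq_abs]
    ring
  rw [e, e, add_sub_right_comm, inner_add_right, real_inner_smul_right] at h3
  rw [inner_neg_left, inner_add_left, inner_add_left, real_inner_smul_left, real_inner_smul_left]
  linarith

/-- Variational inequality for a nearest point of a convex set. -/
theorem inner_le_zero_of_nearest {T : Set V} (hT : Convex ℝ T) {w p u : V} (hp : p ∈ T)
    (hmin : ∀ q ∈ T, ‖w - p‖ ≤ ‖w - q‖) (hu : u ∈ T) : ⟪w - p, u - p⟫ ≤ 0 := by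
  refine le_of_small_perturbation (C := ‖u - p‖ ^ 2 / 2) one_pos fun t h0 h1 => ?_
  have hq : (1 - t) • p + t • u ∈ T := hT hp hu (by linarith) h0.le (by ring)
  have h2 := pow_le_pow_left₀ (norm_nonneg _) (hmin _ hq) 2
  have e : w - ((1 - t) • p + t • u) = (w - p) - t • (u - p) := by module
  rw [e, norm_sub_sq_real (w - p), real_inner_smul_right, norm_smul, mul_pow, Real.norm_eq_abs,
    sq_abs] at h2
  linarith

/-- One projected dual step controls the pairing of the new multiplier with the constraint. -/
theorem dual_step_lower_bound {α ε : ℝ} {y yp w : V} (hαε : α * ε ≤ 1)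
    (h : ⟪y + α • (w - ε • y) - yp, 0 - yp⟫ ≤ 0) :
    (‖yp‖ ^ 2 - ‖y‖ ^ 2) / 2 + α * ε * ‖y‖ ^ 2 / 2
      ≤ α * (⟪yp, w⟫ - ε / 2 * ‖yp‖ ^ 2) := by
  have h1 : ‖yp‖ ^ 2 - (1 - α * ε) * ⟪yp, y⟫ ≤ α * ⟪yp, w⟫ := by
    have e : y + α • (w - ε • y) - yp = (1 - α * ε) • y + α • w - yp := by module
    rw [e, zero_sub, inner_neg_right, inner_sub_left, inner_add_left, real_inner_smul_left,
      real_inner_smul_left, real_inner_self_eq_norm_sq, real_inner_comm, real_inner_comm yp w] at h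
    linarith
  have h2 := norm_sub_sq_real yp y
  have h3 := mul_le_mul_of_nonneg_left (sq_nonneg ‖yp - y‖) (by linarith : 0 ≤ 1 - α * ε)
  rw [h2] at h3
  linarith

end Abstract

theorem sub_le_half_of_deriv_lipschitz {φ φ' : ℝ → ℝ} {C : ℝ}
    (hφ : ∀ t, HasDerivAt φ (φ' t) t)
    (hφ' : ∀ t, 0 ≤ t → t ≤ 1 → φ' t - φ' 0 ≤ C * t) : φ 1 - φ 0 - φ' 0 ≤ C / 2 := by
  have hd : ∀ t, HasDerivAt (fun t => φ t - t * φ' 0 - C / 2 * t ^ 2)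
      (φ' t - 1 * φ' 0 - C / 2 * (2 * t)) t := by
    intro t
    have h1 := (hasDerivAt_id t).mul_const (φ' 0)
    have h2 := ((hasDerivAt_pow 2 t).const_mul (C / 2))
    exact (((hφ t).sub h1).sub h2).congr_deriv (by simp)
  have hanti : AntitoneOn (fun t => φ t - t * φ' 0 - C / 2 * t ^ 2) (Set.Icc 0 1) := by
    refine antitoneOn_of_deriv_nonpos (convex_Icc 0 1)
      (fun t _ => (hd t).continuousAt.continuousWithinAt)
      (fun t _ => (hd t).differentiableAt.differentiableWithinAt) fun t ht => ?_
    rw [interior_Icc] at ht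
    rw [(hd t).deriv]
    have := hφ' t ht.1.le ht.2.le
    linarith
  have := hanti (Set.left_mem_Icc.2 zero_le_one) (Set.right_mem_Icc.2 zero_le_one) zero_le_one
  simp only at this
  linarith

section Frobenius

variable {m n p : ℕ}

theorem frobInner_eq_sum (A B : Matrix (Fin m) (Fin n) ℝ) :
    frobInner A B = ∑ i, ∑ j, A i j * B i j := by
  simp only [frobInner, Matrix.trace, Matrix.diag_apply, Matrix.mul_apply, Matrix.transpose_apply]
  exact Finset.sum_comm

theorem eq_zero_of_frobInner_self {A : Matrix (Fin m) (Fin n) ℝ} (h : frobInner A A = 0) :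
    A = 0 := by
  rw [frobInner_eq_sum] at h
  have h1 := (Finset.sum_eq_zero_iff_of_nonneg (s := Finset.univ)
    (f := fun i => ∑ j, A i j * A i j)
    fun i _ => Finset.sum_nonneg fun j _ => mul_self_nonneg _).1 h
  ext i j
  have h2 := (Finset.sum_eq_zero_iff_of_nonneg (s := Finset.univ) (f := fun j => A i j * A i j)
    fun j _ => mul_self_nonneg _).1 (h1 i (Finset.mem_univ i))
  exact mul_self_eq_zero.1 (h2 j (Finset.mem_univ j))

/-- The Frobenius inner product as an inner product space core. -/
@[reducible] def frobCore (m n : ℕ) : InnerProductSpace.Core ℝ (Matrix (Fin m) (Fin n) ℝ) where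
  inner := frobInner
  conj_inner_symm A B := by
    simp only [frobInner_eq_sum, conj_trivial, mul_comm]
  re_inner_nonneg A := by
    simp only [frobInner_eq_sum, RCLike.re_to_real]
    exact Finset.sum_nonneg fun i _ => Finset.sum_nonneg fun j _ => mul_self_nonneg _
  add_left A B C := by
    simp only [frobInner_eq_sum, Matrix.add_apply, add_mul, Finset.sum_add_distrib]
  smul_left A B c := by
    simp only [frobInner_eq_sum, Matrix.smul_apply, smul_eq_mul, conj_trivial, Finset.mul_sum,
      mul_assoc]
  definite A h := eq_zero_of_frobInner_self h

/-- Matrices normed by the Frobenius norm. -/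
@[reducible] def frobNormedAddCommGroup (m n : ℕ) :
    NormedAddCommGroup (Matrix (Fin m) (Fin n) ℝ) :=
  (frobCore m n).toNormedAddCommGroup

attribute [local instance] frobNormedAddCommGroup

/-- Matrices with the Frobenius inner product. -/
@[reducible] def frobInnerProductSpace (m n : ℕ) :
    InnerProductSpace ℝ (Matrix (Fin m) (Fin n) ℝ) :=
  InnerProductSpace.ofCore (frobCore m n).toCore

attribute [local instance] frobInnerProductSpace

open scoped RealInnerProductSpace

theorem frobNorm_eq_norm (A : Matrix (Fin m) (Fin n) ℝ) : frobNorm A = ‖A‖ := rfl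

theorem frobInner_eq_inner (A B : Matrix (Fin m) (Fin n) ℝ) : frobInner A B = ⟪A, B⟫ := rfl

theorem frob_norm_sq (A : Matrix (Fin m) (Fin n) ℝ) : ‖A‖ ^ 2 = ∑ i, ∑ j, A i j ^ 2 := by
  rw [← real_inner_self_eq_norm_sq, ← frobInner_eq_inner, frobInner_eq_sum]
  simp only [sq]

theorem frob_norm_transpose (A : Matrix (Fin m) (Fin n) ℝ) : ‖Aᵀ‖ = ‖A‖ := by
  have : ‖Aᵀ‖ ^ 2 = ‖A‖ ^ 2 := by
    rw [frob_norm_sq, frob_norm_sq, Finset.sum_comm]; rfl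
  exact (sq_eq_sq₀ (norm_nonneg _) (norm_nonneg _)).1 this

theorem frob_inner_mul_right (A : Matrix (Fin m) (Fin n) ℝ) (B : Matrix (Fin m) (Fin p) ℝ)
    (C : Matrix (Fin p) (Fin n) ℝ) : ⟪A, B * C⟫ = ⟪Bᵀ * A, C⟫ := by
  simp only [← frobInner_eq_inner, frobInner, Matrix.transpose_mul, Matrix.transpose_transpose,
    Matrix.mul_assoc]

theorem frob_inner_transpose (A B : Matrix (Fin m) (Fin n) ℝ) : ⟪Aᵀ, Bᵀ⟫ = ⟪A, B⟫ := by
  simp only [← frobInner_eq_inner, frobInner_eq_sum, Matrix.transpose_apply]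
  exact Finset.sum_comm

theorem frob_norm_mul_le (A : Matrix (Fin m) (Fin p) ℝ) (B : Matrix (Fin p) (Fin n) ℝ) :
    ‖A * B‖ ≤ ‖A‖ * ‖B‖ := by
  refine (sq_le_sq₀ (norm_nonneg _) (by positivity)).1 ?_
  rw [mul_pow, ← frob_norm_transpose B, frob_norm_sq, frob_norm_sq, frob_norm_sq,
    Finset.sum_mul_sum]
  refine Finset.sum_le_sum fun i _ => Finset.sum_le_sum fun j _ => ?_
  rw [Matrix.mul_apply]
  exact Finset.sum_mul_sq_le_sq_mul_sq _ _ _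

theorem specNorm_nonneg (A : Matrix (Fin m) (Fin n) ℝ) : 0 ≤ specNorm A :=
  norm_nonneg (LinearMap.toContinuousLinearMap (Matrix.toEuclideanLin A))

theorem frob_norm_mul_le_spec (A : Matrix (Fin m) (Fin p) ℝ) (B : Matrix (Fin p) (Fin n) ℝ) :
    ‖A * B‖ ≤ specNorm A * ‖B‖ := by
  refine (sq_le_sq₀ (norm_nonneg _) (mul_nonneg (specNorm_nonneg A) (norm_nonneg _))).1 ?_
  have e1 : ‖A * B‖ ^ 2 = ∑ j, ∑ i, (A * B) i j ^ 2 := by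
    rw [frob_norm_sq, Finset.sum_comm]
  have e2 : ‖B‖ ^ 2 = ∑ j, ∑ i, B i j ^ 2 := by
    rw [frob_norm_sq, Finset.sum_comm]
  rw [mul_pow, e1, e2, Finset.mul_sum]
  refine Finset.sum_le_sum fun j _ => ?_
  have h := (LinearMap.toContinuousLinearMap (Matrix.toEuclideanLin A)).le_opNorm
    (WithLp.toLp 2 (fun i => B i j))
  have h2 := pow_le_pow_left₀ (norm_nonneg _) h 2
  rw [mul_pow, EuclideanSpace.real_norm_sq_eq, EuclideanSpace.real_norm_sq_eq] at h2
  exact h2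

theorem frob_norm_transpose_mul_le_spec (A : Matrix (Fin p) (Fin m) ℝ)
    (B : Matrix (Fin p) (Fin n) ℝ) : ‖Aᵀ * B‖ ≤ specNorm A * ‖B‖ := by
  have h : ‖Aᵀ * B‖ ^ 2 ≤ specNorm A * ‖B‖ * ‖Aᵀ * B‖ := by
    rw [← real_inner_self_eq_norm_sq, frob_inner_mul_right, Matrix.transpose_transpose]
    refine (real_inner_le_norm _ _).trans ?_
    have := mul_le_mul_of_nonneg_right (frob_norm_mul_le_spec A (Aᵀ * B)) (norm_nonneg B)
    linarith
  have h0 := mul_nonneg (specNorm_nonneg A) (norm_nonneg B)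
  by_contra hlt
  push Not at hlt
  have := mul_lt_mul_of_pos_right hlt (lt_of_le_of_lt h0 hlt)
  linarith [sq ‖Aᵀ * B‖]

theorem frob_norm_mul_le_spec_right (B : Matrix (Fin m) (Fin n) ℝ)
    (A : Matrix (Fin n) (Fin p) ℝ) : ‖B * A‖ ≤ specNorm A * ‖B‖ := by
  rw [← frob_norm_transpose (B * A), Matrix.transpose_mul, ← frob_norm_transpose B]
  exact frob_norm_transpose_mul_le_spec _ _

theorem frob_norm_mul_transpose_le_spec (B : Matrix (Fin m) (Fin n) ℝ)
    (A : Matrix (Fin p) (Fin n) ℝ) : ‖B * Aᵀ‖ ≤ specNorm A * ‖B‖ := by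
  rw [← frob_norm_transpose (B * Aᵀ), Matrix.transpose_mul, Matrix.transpose_transpose,
    ← frob_norm_transpose B]
  exact frob_norm_mul_le_spec _ _

theorem Gm_sub (X X' : Matrix (Fin m) (Fin n) ℝ) :
    Gm X' - Gm X = X'ᵀ * (X' - X) + (X' - X)ᵀ * X := by
  simp only [Gm, Matrix.transpose_sub, Matrix.mul_sub, Matrix.sub_mul]; abel

theorem norm_Gm_sub_le {R : ℝ} {X X' : Matrix (Fin m) (Fin n) ℝ} (hX : specNorm X ≤ R)
    (hX' : specNorm X' ≤ R) : ‖Gm X' - Gm X‖ ≤ 2 * R * ‖X' - X‖ := by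
  rw [Gm_sub]
  refine (norm_add_le _ _).trans ?_
  have h1 := frob_norm_transpose_mul_le_spec X' (X' - X)
  have h2 := frob_norm_mul_le_spec_right (X' - X)ᵀ X
  rw [frob_norm_transpose] at h2
  nlinarith [norm_nonneg (X' - X)]

theorem Gm_add (X H : Matrix (Fin m) (Fin n) ℝ) :
    Gm (X + H) = Gm X + (Xᵀ * H + (Xᵀ * H)ᵀ) + Hᵀ * H := by
  simp only [Gm, Matrix.transpose_add, Matrix.mul_add, Matrix.add_mul, Matrix.transpose_mul,
    Matrix.transpose_transpose]; abel

theorem inner_symm_Gm_add {W : Matrix (Fin n) (Fin n) ℝ} (hW : W.IsSymm)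
    (X H : Matrix (Fin m) (Fin n) ℝ) :
    ⟪W, Gm (X + H)⟫ = ⟪W, Gm X⟫ + ⟪(2 : ℝ) • (X * W), H⟫ + ⟪W, Hᵀ * H⟫ := by
  have h1 : ⟪W, Xᵀ * H⟫ = ⟪X * W, H⟫ := by
    rw [frob_inner_mul_right, Matrix.transpose_transpose]
  have h2 : ⟪W, (Xᵀ * H)ᵀ⟫ = ⟪X * W, H⟫ := by
    rw [← h1, ← frob_inner_transpose, hW.eq, Matrix.transpose_transpose]
  rw [Gm_add, inner_add_right, inner_add_right, inner_add_right, h1, h2, real_inner_smul_left]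
  ring

theorem Gm_isSymm (X : Matrix (Fin m) (Fin n) ℝ) : (Gm X).IsSymm := by
  simp [Gm, Matrix.IsSymm, Matrix.transpose_mul]

/-- Upper and lower quadratic models of the penalty `‖G(X)‖²`. -/
theorem norm_sq_Gm_model {R : ℝ} {X X' : Matrix (Fin m) (Fin n) ℝ} (hX : specNorm X ≤ R)
    (hX' : specNorm X' ≤ R) :
    -(2 * ‖X' - X‖ ^ 2)
        ≤ ‖Gm X'‖ ^ 2 - ‖Gm X‖ ^ 2 - 2 * ⟪(2 : ℝ) • (X * Gm X), X' - X⟫ ∧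
      ‖Gm X'‖ ^ 2 - ‖Gm X‖ ^ 2 - 2 * ⟪(2 : ℝ) • (X * Gm X), X' - X⟫
        ≤ (6 * R ^ 2 + 2) * ‖X' - X‖ ^ 2 := by
  have hR : 0 ≤ R := (specNorm_nonneg X).trans hX
  set H := X' - X with hH
  have hX'eq : X' = X + H := by rw [hH]; abel
  have h1 := inner_symm_Gm_add (Gm_isSymm X) X H
  rw [← hX'eq] at h1
  have h2 : ‖Gm X'‖ ^ 2 = ‖Gm X‖ ^ 2 + 2 * (⟪Gm X, Gm X'⟫ - ⟪Gm X, Gm X⟫) + ‖Gm X' - Gm X‖ ^ 2 := by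
    rw [norm_sub_sq_real, real_inner_self_eq_norm_sq, real_inner_comm (Gm X) (Gm X')]; ring
  have h3 : ⟪Gm X, Hᵀ * H⟫ = ‖H * Xᵀ‖ ^ 2 - ‖H‖ ^ 2 := by
    have e1 : ⟪Xᵀ * X, Hᵀ * H⟫ = ‖H * Xᵀ‖ ^ 2 := by
      rw [frob_inner_mul_right, Matrix.transpose_transpose, ← Matrix.mul_assoc,
        ← frob_inner_transpose, Matrix.transpose_mul, real_inner_comm, frob_inner_mul_right,
        Matrix.transpose_transpose, real_inner_comm, ← real_inner_self_eq_norm_sq,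
        ← frob_inner_transpose (H * Xᵀ) (H * Xᵀ)]
      simp only [Matrix.transpose_mul, Matrix.transpose_transpose]
    have e2 : ⟪(1 : Matrix (Fin n) (Fin n) ℝ), Hᵀ * H⟫ = ‖H‖ ^ 2 := by
      rw [frob_inner_mul_right, Matrix.transpose_transpose, Matrix.mul_one,
        real_inner_self_eq_norm_sq]
    rw [Gm, inner_sub_left, e1, e2]
  have h4 : ‖Gm X' - Gm X‖ ^ 2 ≤ (2 * R * ‖H‖) ^ 2 :=
    pow_le_pow_left₀ (norm_nonneg _) (norm_Gm_sub_le hX hX') 2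
  have h5 : ‖H * Xᵀ‖ ^ 2 ≤ (R * ‖H‖) ^ 2 :=
    pow_le_pow_left₀ (norm_nonneg _) ((frob_norm_mul_transpose_le_spec H X).trans
      (mul_le_mul_of_nonneg_right hX (norm_nonneg _))) 2
  have h6 := sq_nonneg ‖H * Xᵀ‖
  have h7 := sq_nonneg ‖Gm X' - Gm X‖
  have h8 := sq_nonneg ‖H‖
  constructor <;> linarith

theorem inner_Gm_model {RY : ℝ} {W : Matrix (Fin n) (Fin n) ℝ} (hW : W.IsSymm) (hWR : ‖W‖ ≤ RY)
    (X X' : Matrix (Fin m) (Fin n) ℝ) :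
    |⟪W, Gm X'⟫ - ⟪W, Gm X⟫ - ⟪(2 : ℝ) • (X * W), X' - X⟫| ≤ RY * ‖X' - X‖ ^ 2 := by
  have h1 := inner_symm_Gm_add hW X (X' - X)
  rw [add_sub_cancel] at h1
  rw [h1]
  have h2 : ⟪W, Gm X⟫ + ⟪(2 : ℝ) • (X * W), X' - X⟫ + ⟪W, (X' - X)ᵀ * (X' - X)⟫ - ⟪W, Gm X⟫
      - ⟪(2 : ℝ) • (X * W), X' - X⟫ = ⟪W, (X' - X)ᵀ * (X' - X)⟫ := by ring
  rw [h2]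
  have h3 := frob_norm_mul_le (X' - X)ᵀ (X' - X)
  rw [frob_norm_transpose] at h3
  refine (abs_real_inner_le_norm _ _).trans ?_
  rw [sq]
  exact mul_le_mul hWR h3 (norm_nonneg _) ((norm_nonneg _).trans hWR)

/-- The gradient of the smooth part of the augmented Lagrangian is Lipschitz. -/
theorem norm_smoothGrad_sub_le {Lℓ RY ρ R : ℝ} (hρ : 0 ≤ ρ)
    {X X' V V' : Matrix (Fin m) (Fin n) ℝ}
    {W : Matrix (Fin n) (Fin n) ℝ} (hX : specNorm X ≤ R) (hX' : specNorm X' ≤ R)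
    (hWR : ‖W‖ ≤ RY) (hV : ‖V' - V‖ ≤ Lℓ * ‖X' - X‖) :
    ‖(V' + (2 : ℝ) • (X' * (W + ρ • Gm X'))) - (V + (2 : ℝ) • (X * (W + ρ • Gm X)))‖
      ≤ (Lℓ + 2 * RY + 6 * ρ * R ^ 2 + 2 * ρ) * ‖X' - X‖ := by
  have hR : 0 ≤ R := (specNorm_nonneg X).trans hX
  have e1 : (V' + (2 : ℝ) • (X' * (W + ρ • Gm X'))) - (V + (2 : ℝ) • (X * (W + ρ • Gm X)))
      = (V' - V) + (2 : ℝ) • ((X' - X) * W) + (2 * ρ) • (X' * Gm X' - X * Gm X) := by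
    simp only [Matrix.mul_add, Matrix.sub_mul, Matrix.mul_smul]
    module
  have e2 : X' * Gm X' - X * Gm X
      = (X' - X) * (X'ᵀ * X') + X * ((X' - X)ᵀ * X') + X * (Xᵀ * (X' - X)) - (X' - X) := by
    simp only [Gm, Matrix.mul_sub, Matrix.sub_mul, Matrix.transpose_sub, Matrix.mul_one]
    abel
  have t1 : ‖(X' - X) * (X'ᵀ * X')‖ ≤ R ^ 2 * ‖X' - X‖ := by
    rw [← Matrix.mul_assoc]
    have a1 := frob_norm_mul_le_spec_right ((X' - X) * X'ᵀ) X'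
    have a2 := frob_norm_mul_transpose_le_spec (X' - X) X'
    have a3 : ‖(X' - X) * X'ᵀ‖ ≤ R * ‖X' - X‖ :=
      a2.trans (mul_le_mul_of_nonneg_right hX' (norm_nonneg _))
    calc _ ≤ _ := a1
      _ ≤ R * (R * ‖X' - X‖) := mul_le_mul hX' a3 (norm_nonneg _) hR
      _ = _ := by ring
  have t2 : ‖X * ((X' - X)ᵀ * X')‖ ≤ R ^ 2 * ‖X' - X‖ := by
    have a1 := frob_norm_mul_le_spec X ((X' - X)ᵀ * X')
    have a2 := frob_norm_mul_le_spec_right (X' - X)ᵀ X'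
    rw [frob_norm_transpose] at a2
    have a3 := a2.trans (mul_le_mul_of_nonneg_right hX' (norm_nonneg _))
    calc _ ≤ _ := a1
      _ ≤ R * (R * ‖X' - X‖) := mul_le_mul hX a3 (norm_nonneg _) hR
      _ = _ := by ring
  have t3 : ‖X * (Xᵀ * (X' - X))‖ ≤ R ^ 2 * ‖X' - X‖ := by
    have a1 := frob_norm_mul_le_spec X (Xᵀ * (X' - X))
    have a3 := (frob_norm_transpose_mul_le_spec X (X' - X)).trans
      (mul_le_mul_of_nonneg_right hX (norm_nonneg _))
    calc _ ≤ _ := a1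
      _ ≤ R * (R * ‖X' - X‖) := mul_le_mul hX a3 (norm_nonneg _) hR
      _ = _ := by ring
  have t4 : ‖X' * Gm X' - X * Gm X‖ ≤ (3 * R ^ 2 + 1) * ‖X' - X‖ := by
    rw [e2]
    have b1 := norm_sub_le ((X' - X) * (X'ᵀ * X') + X * ((X' - X)ᵀ * X') + X * (Xᵀ * (X' - X)))
      (X' - X)
    have b2 := norm_add₃_le (a := (X' - X) * (X'ᵀ * X')) (b := X * ((X' - X)ᵀ * X'))
      (c := X * (Xᵀ * (X' - X)))
    linarith
  have t5 : ‖(X' - X) * W‖ ≤ RY * ‖X' - X‖ := by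
    rw [mul_comm]
    exact (frob_norm_mul_le _ _).trans (mul_le_mul_of_nonneg_left hWR (norm_nonneg _))
  rw [e1]
  have b3 := norm_add₃_le (a := V' - V) (b := (2 : ℝ) • ((X' - X) * W))
    (c := (2 * ρ) • (X' * Gm X' - X * Gm X))
  rw [norm_smul, norm_smul, Real.norm_eq_abs, Real.norm_eq_abs, abs_of_pos (by norm_num : (0:ℝ) < 2),
    abs_of_nonneg (by positivity : 0 ≤ 2 * ρ)] at b3
  have b4 := mul_le_mul_of_nonneg_left t4 (by positivity : 0 ≤ 2 * ρ)
  linarith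

/-- Near-orthonormal columns bound the smallest singular value from below. -/
theorem one_sub_mul_norm_sq_le (X : Matrix (Fin m) (Fin n) ℝ) (W : Matrix (Fin n) (Fin n) ℝ) :
    (1 - ‖Gm X‖) * ‖W‖ ^ 2 ≤ ‖X * W‖ ^ 2 := by
  have h1 : ‖X * W‖ ^ 2 = ‖W‖ ^ 2 + ⟪Gm X * W, W⟫ := by
    rw [← real_inner_self_eq_norm_sq, frob_inner_mul_right, ← Matrix.mul_assoc, Gm, Matrix.sub_mul,
      Matrix.one_mul, inner_sub_left, real_inner_self_eq_norm_sq]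
    ring
  have h2 := (abs_real_inner_le_norm (Gm X * W) W).trans
    (mul_le_mul_of_nonneg_right (frob_norm_mul_le (Gm X) W) (norm_nonneg W))
  have h3 := (abs_le.1 h2).1
  nlinarith

theorem IsGradientOf.hasDerivAt_line {gradl : Matrix (Fin m) (Fin n) ℝ → Matrix (Fin m) (Fin n) ℝ}
    {ℓ : Matrix (Fin m) (Fin n) ℝ → ℝ} (h : IsGradientOf gradl ℓ)
    (X H : Matrix (Fin m) (Fin n) ℝ) (t : ℝ) :
    HasDerivAt (fun t : ℝ => ℓ (X + t • H)) ⟪gradl (X + t • H), H⟫ t := by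
  rw [hasDerivAt_iff_isLittleO_nhds_zero, Asymptotics.isLittleO_iff]
  intro c hc
  have hH : 0 < ‖H‖ + 1 := by positivity
  obtain ⟨δ, hδ, hb⟩ := h (X + t • H) (c / (‖H‖ + 1)) (by positivity)
  filter_upwards [Metric.ball_mem_nhds (0 : ℝ) (by positivity : 0 < δ / (‖H‖ + 1))] with s hs
  have hs' : |s| * (‖H‖ + 1) < δ := by
    rwa [Metric.mem_ball, dist_zero_right, Real.norm_eq_abs, lt_div_iff₀ hH] at hs
  have hn : ‖s • H‖ = |s| * ‖H‖ := by rw [norm_smul, Real.norm_eq_abs]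
  have h1 := hb (s • H) (by rw [frobNorm_eq_norm, hn]; nlinarith [abs_nonneg s])
  rw [frobNorm_eq_norm, hn, frobInner_eq_inner, real_inner_smul_right] at h1
  have e : X + (t + s) • H = X + t • H + s • H := by module
  rw [e, Real.norm_eq_abs, Real.norm_eq_abs, smul_eq_mul]
  refine h1.trans ?_
  rw [div_mul_eq_mul_div, div_le_iff₀ hH]
  nlinarith [mul_nonneg hc.le (abs_nonneg s)]

theorem IsGradientOf.model {gradl : Matrix (Fin m) (Fin n) ℝ → Matrix (Fin m) (Fin n) ℝ}
    {ℓ : Matrix (Fin m) (Fin n) ℝ → ℝ} (h : IsGradientOf gradl ℓ)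
    {S : Set (Matrix (Fin m) (Fin n) ℝ)} (hS : Convex ℝ S) {L : ℝ}
    (hlip : ∀ X ∈ S, ∀ X' ∈ S, ‖gradl X - gradl X'‖ ≤ L * ‖X - X'‖)
    {X X' : Matrix (Fin m) (Fin n) ℝ} (hX : X ∈ S) (hX' : X' ∈ S) :
    |ℓ X' - ℓ X - ⟪gradl X, X' - X⟫| ≤ L / 2 * ‖X' - X‖ ^ 2 := by
  set H := X' - X with hH
  have hd := h.hasDerivAt_line X H
  have hb : ∀ t : ℝ, 0 ≤ t → t ≤ 1 →
      |⟪gradl (X + t • H), H⟫ - ⟪gradl (X + (0 : ℝ) • H), H⟫| ≤ L * ‖H‖ ^ 2 * t := by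
    intro t h0 h1
    rw [zero_smul, add_zero, ← inner_sub_left]
    have hm : X + t • H ∈ S := by
      have := hS hX hX' (by linarith : 0 ≤ 1 - t) h0 (by ring)
      have e : X + t • H = (1 - t) • X + t • X' := by rw [hH]; module
      rwa [e]
    have h2 := hlip _ hm _ hX
    rw [add_sub_cancel_left, norm_smul, Real.norm_eq_abs, abs_of_nonneg h0] at h2
    have h3 := (abs_real_inner_le_norm (gradl (X + t • H) - gradl X) H).trans
      (mul_le_mul_of_nonneg_right h2 (norm_nonneg _))
    linarith
  have up := sub_le_half_of_deriv_lipschitz hd (fun t h0 h1 => (abs_le.1 (hb t h0 h1)).2)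
  have lo := sub_le_half_of_deriv_lipschitz (φ := fun t => -ℓ (X + t • H))
    (φ' := fun t => -⟪gradl (X + t • H), H⟫) (C := L * ‖H‖ ^ 2) (fun t => (hd t).neg)
    (fun t h0 h1 => by have := (abs_le.1 (hb t h0 h1)).1; linarith)
  have e1 : X + (1 : ℝ) • H = X' := by rw [hH]; module
  simp only [e1, zero_smul, add_zero] at up lo
  rw [abs_le]
  constructor <;> linarith

/-- Smooth part of the augmented Lagrangian. -/
def smoothLag (ℓ : Matrix (Fin m) (Fin n) ℝ → ℝ) (ρ : ℝ) (W : Matrix (Fin n) (Fin n) ℝ)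
    (X : Matrix (Fin m) (Fin n) ℝ) : ℝ :=
  ℓ X + frobInner W (Gm X) + ρ / 2 * frobNorm (Gm X) ^ 2

/-- Gradient of the smooth part of the augmented Lagrangian. -/
def smoothGrad (gradl : Matrix (Fin m) (Fin n) ℝ → Matrix (Fin m) (Fin n) ℝ) (ρ : ℝ)
    (W : Matrix (Fin n) (Fin n) ℝ) (X : Matrix (Fin m) (Fin n) ℝ) : Matrix (Fin m) (Fin n) ℝ :=
  gradl X + (2 : ℝ) • (X * (W + ρ • Gm X))

theorem smoothLag_model {gradl : Matrix (Fin m) (Fin n) ℝ → Matrix (Fin m) (Fin n) ℝ}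
    {ℓ : Matrix (Fin m) (Fin n) ℝ → ℝ} (h : IsGradientOf gradl ℓ)
    {S : Set (Matrix (Fin m) (Fin n) ℝ)} (hS : Convex ℝ S) {L R RY ρ : ℝ} (hρ : 0 ≤ ρ)
    (hlip : ∀ X ∈ S, ∀ X' ∈ S, ‖gradl X - gradl X'‖ ≤ L * ‖X - X'‖)
    (hSR : ∀ X ∈ S, specNorm X ≤ R) {W : Matrix (Fin n) (Fin n) ℝ} (hW : W.IsSymm)
    (hWR : ‖W‖ ≤ RY) {X X' : Matrix (Fin m) (Fin n) ℝ} (hX : X ∈ S) (hX' : X' ∈ S) :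
    -((L + 2 * RY + 2 * ρ) / 2 * ‖X' - X‖ ^ 2)
        ≤ smoothLag ℓ ρ W X' - smoothLag ℓ ρ W X - ⟪smoothGrad gradl ρ W X, X' - X⟫ ∧
      smoothLag ℓ ρ W X' - smoothLag ℓ ρ W X - ⟪smoothGrad gradl ρ W X, X' - X⟫
        ≤ (L + 2 * RY + 6 * ρ * R ^ 2 + 2 * ρ) / 2 * ‖X' - X‖ ^ 2 := by
  have h1 := abs_le.1 (h.model hS hlip hX hX')
  have h2 := abs_le.1 (inner_Gm_model hW hWR X X')
  obtain ⟨h3, h4⟩ := norm_sq_Gm_model (hSR X hX) (hSR X' hX')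
  have e : ⟪smoothGrad gradl ρ W X, X' - X⟫ = ⟪gradl X, X' - X⟫ + ⟪(2 : ℝ) • (X * W), X' - X⟫
      + ρ * ⟪(2 : ℝ) • (X * Gm X), X' - X⟫ := by
    rw [← real_inner_smul_left, ← inner_add_left, ← inner_add_left]
    congr 1
    simp only [smoothGrad, Matrix.mul_add, Matrix.mul_smul]
    module
  have h5 := mul_le_mul_of_nonneg_left h3 (by positivity : 0 ≤ ρ / 2)
  have h6 := mul_le_mul_of_nonneg_left h4 (by positivity : 0 ≤ ρ / 2)
  rw [e]
  simp only [smoothLag, frobInner_eq_inner, frobNorm_eq_norm]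
  constructor <;> linarith

theorem Ffun_eq_regLag (ℓ g : Matrix (Fin m) (Fin n) ℝ → ℝ) (ρ r ε : ℝ)
    (X : Matrix (Fin m) (Fin n) ℝ) (W : Matrix (Fin n) (Fin n) ℝ) (Z : Matrix (Fin m) (Fin n) ℝ) :
    Ffun ℓ g ρ r ε X W Z
      = regLag (fun X => ℓ X + g X + ρ / 2 * frobNorm (Gm X) ^ 2) Gm ε r X W Z := by
  simp only [Ffun, Lag, regLag, frobInner_eq_inner, frobNorm_eq_norm]
  ring

theorem Ffun_eq_smoothLag (ℓ g : Matrix (Fin m) (Fin n) ℝ → ℝ) (ρ r ε : ℝ)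
    (X : Matrix (Fin m) (Fin n) ℝ) (W : Matrix (Fin n) (Fin n) ℝ) (Z : Matrix (Fin m) (Fin n) ℝ) :
    Ffun ℓ g ρ r ε X W Z
      = smoothLag ℓ ρ W X + g X + r / 2 * ‖X - Z‖ ^ 2 - ε / 2 * ‖W‖ ^ 2 := by
  simp only [Ffun, Lag, smoothLag, frobNorm_eq_norm]
  ring

theorem LinLag_eq (ℓ g : Matrix (Fin m) (Fin n) ℝ → ℝ)
    (gradl : Matrix (Fin m) (Fin n) ℝ → Matrix (Fin m) (Fin n) ℝ) (ρ lam : ℝ)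
    (Xb X : Matrix (Fin m) (Fin n) ℝ) (W : Matrix (Fin n) (Fin n) ℝ) :
    LinLag ℓ g gradl ρ lam Xb X W = smoothLag ℓ ρ W Xb + g X
      + ⟪smoothGrad gradl ρ W Xb, X - Xb⟫ + lam⁻¹ / 2 * ‖X - Xb‖ ^ 2 := by
  have e : 1 / (2 * lam) = lam⁻¹ / 2 := by rw [one_div, mul_inv]; ring
  simp only [LinLag, smoothLag, smoothGrad, frobInner_eq_inner, frobNorm_eq_norm, inner_add_left, e]
  ring

theorem hasGrowthMin_Ffun {gradl : Matrix (Fin m) (Fin n) ℝ → Matrix (Fin m) (Fin n) ℝ}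
    {ℓ g : Matrix (Fin m) (Fin n) ℝ → ℝ} (h : IsGradientOf gradl ℓ)
    {S : Set (Matrix (Fin m) (Fin n) ℝ)} {T : Set (Matrix (Fin n) (Fin n) ℝ)} (hS : Convex ℝ S)
    {L Lg R RY ρ r ε : ℝ} (hρ : 0 ≤ ρ)
    (hlip : ∀ X ∈ S, ∀ X' ∈ S, ‖gradl X - gradl X'‖ ≤ L * ‖X - X'‖)
    (hg : ConvexOn ℝ S (fun X => g X + Lg / 2 * ‖X‖ ^ 2))
    (hSR : ∀ X ∈ S, specNorm X ≤ R) (hT : ∀ W ∈ T, W.IsSymm) (hTR : ∀ W ∈ T, ‖W‖ ≤ RY)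
    {xm : Matrix (Fin n) (Fin n) ℝ → Matrix (Fin m) (Fin n) ℝ → Matrix (Fin m) (Fin n) ℝ}
    (hxm : ∀ Y Z, xm Y Z ∈ S ∧ ∀ X' ∈ S, Ffun ℓ g ρ r ε (xm Y Z) Y Z ≤ Ffun ℓ g ρ r ε X' Y Z) :
    HasGrowthMin (fun X => ℓ X + g X + ρ / 2 * frobNorm (Gm X) ^ 2) Gm ε r
      (r - (L + Lg + 2 * RY + 2 * ρ)) S T xm := by
  intro W hW Z
  refine ⟨(hxm W Z).1, fun u hu => ?_⟩
  have hmin := (hxm W Z).2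
  rw [← Ffun_eq_regLag, ← Ffun_eq_regLag, Ffun_eq_smoothLag, Ffun_eq_smoothLag]
  have := quadratic_growth_of_isMin hS
    (h := fun X => smoothLag ℓ ρ W X + r / 2 * ‖X - Z‖ ^ 2) (g := g)
    (κ := L + 2 * RY + 2 * ρ - r) (Lg := Lg) ?_ hg (hxm W Z).1
    (fun u hu => by
      have := hmin u hu
      rw [Ffun_eq_smoothLag, Ffun_eq_smoothLag] at this
      linarith) hu
  · linarith
  · intro X hX
    refine ⟨smoothGrad gradl ρ W X + r • (X - Z), fun X' hX' => ?_⟩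
    have h1 := (smoothLag_model h hS hρ hlip hSR (hT W hW) (hTR W hW) hX hX').1
    have e : ‖X' - Z‖ ^ 2 = ‖X - Z‖ ^ 2 + 2 * ⟪X - Z, X' - X⟫ + ‖X' - X‖ ^ 2 := by
      rw [← norm_add_sq_real]; congr 2; abel
    rw [inner_add_left, real_inner_smul_left, e]
    linarith

/-- Bound on the multiplier from the residuals of one primal step. -/
theorem norm_multiplier_le {gradl : Matrix (Fin m) (Fin n) ℝ → Matrix (Fin m) (Fin n) ℝ}
    {ℓ g : Matrix (Fin m) (Fin n) ℝ → ℝ} (h : IsGradientOf gradl ℓ)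
    {S : Set (Matrix (Fin m) (Fin n) ℝ)} (hS : Convex ℝ S)
    {L Lg R RY ρ r c δ : ℝ} (hL : 0 ≤ L) (hLg : 0 ≤ Lg) (hρ : 0 ≤ ρ) (hr : 0 ≤ r) (hc : 0 ≤ c)
    (hδ1 : δ < 1)
    (hlip : ∀ X ∈ S, ∀ X' ∈ S, ‖gradl X - gradl X'‖ ≤ L * ‖X - X'‖)
    (hℓlip : ∀ X ∈ S, ∀ X' ∈ S, |ℓ X - ℓ X'| ≤ L * ‖X - X'‖)
    (hglip : ∀ X ∈ S, ∀ X' ∈ S, |g X - g X'| ≤ Lg * ‖X - X'‖)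
    (hSR : ∀ X ∈ S, specNorm X ≤ R)
    {W : Matrix (Fin n) (Fin n) ℝ} (hWR : ‖W‖ ≤ RY)
    {x xp z : Matrix (Fin m) (Fin n) ℝ} (hx : x ∈ S) (hxp : xp ∈ S)
    (hint : ∀ H, ∃ t₀ : ℝ, 0 < t₀ ∧ ∀ t, 0 < t → t ≤ t₀ → xp + t • H ∈ S)
    (hfeas : ‖Gm xp‖ ≤ δ)
    (hmin : ∀ u ∈ S, g xp + ⟪smoothGrad gradl ρ W x, xp - x⟫ + c / 2 * ‖xp - x‖ ^ 2
        + r / 2 * ‖xp - z‖ ^ 2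
      ≤ g u + ⟪smoothGrad gradl ρ W x, u - x⟫ + c / 2 * ‖u - x‖ ^ 2 + r / 2 * ‖u - z‖ ^ 2) :
    2 * Real.sqrt (1 - δ) * ‖W‖ ≤ L + Lg + 2 * ρ * R
      + ((L + 2 * RY + 6 * ρ * R ^ 2 + 2 * ρ) + c) * ‖xp - x‖ + r * ‖xp - z‖ := by
  have hR : 0 ≤ R := (specNorm_nonneg x).trans (hSR x hx)
  have h1 := norm_prox_stationarity_le hLg hint (fun u hu => hglip u hu xp hxp) hmin
  have h2 := norm_gradient_le_of_lipschitz hL hint (fun u hu => hℓlip u hu xp hxp)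
    (fun u hu => h.model hS hlip hxp hu)
  have h3 : ‖smoothGrad gradl ρ W xp - smoothGrad gradl ρ W x‖ ≤ _ :=
    norm_smoothGrad_sub_le hρ (hSR x hx) (hSR xp hxp) hWR (hlip xp hxp x hx)
  have e : (2 : ℝ) • (xp * W)
      = (smoothGrad gradl ρ W x + c • (xp - x) + r • (xp - z))
        + (smoothGrad gradl ρ W xp - smoothGrad gradl ρ W x)
        - (gradl xp + (2 * ρ) • (xp * Gm xp) + c • (xp - x) + r • (xp - z)) := by
    simp only [smoothGrad, Matrix.mul_add, Matrix.mul_smul]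
    module
  have h4 : ‖xp * Gm xp‖ ≤ R * 1 :=
    (frob_norm_mul_le_spec _ _).trans
      (mul_le_mul (hSR xp hxp) (by linarith) (norm_nonneg _) hR)
  have h5 : ‖(2 : ℝ) • (xp * W)‖ ≤ L + Lg + 2 * ρ * R
      + ((L + 2 * RY + 6 * ρ * R ^ 2 + 2 * ρ) + c) * ‖xp - x‖ + r * ‖xp - z‖ := by
    have a1 := norm_sub_le ((smoothGrad gradl ρ W x + c • (xp - x) + r • (xp - z))
        + (smoothGrad gradl ρ W xp - smoothGrad gradl ρ W x))
        (gradl xp + (2 * ρ) • (xp * Gm xp) + c • (xp - x) + r • (xp - z))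
    have a2 := norm_add_le (smoothGrad gradl ρ W x + c • (xp - x) + r • (xp - z))
        (smoothGrad gradl ρ W xp - smoothGrad gradl ρ W x)
    have a3 := norm_add_le (gradl xp + (2 * ρ) • (xp * Gm xp) + c • (xp - x)) (r • (xp - z))
    have a4 := norm_add₃_le (a := gradl xp) (b := (2 * ρ) • (xp * Gm xp)) (c := c • (xp - x))
    have a5 : ‖r • (xp - z)‖ = r * ‖xp - z‖ := by
      rw [norm_smul, Real.norm_eq_abs, abs_of_nonneg hr]
    have a6 : ‖c • (xp - x)‖ = c * ‖xp - x‖ := by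
      rw [norm_smul, Real.norm_eq_abs, abs_of_nonneg hc]
    have a7 : ‖(2 * ρ) • (xp * Gm xp)‖ = 2 * ρ * ‖xp * Gm xp‖ := by
      rw [norm_smul, Real.norm_eq_abs, abs_of_nonneg (by positivity)]
    have a8 := mul_le_mul_of_nonneg_left h4 (by positivity : 0 ≤ 2 * ρ)
    rw [← e] at a1
    linarith
  have h6 : Real.sqrt (1 - δ) * ‖W‖ ≤ ‖xp * W‖ := by
    refine (sq_le_sq₀ (by positivity) (norm_nonneg _)).1 ?_
    rw [mul_pow, Real.sq_sqrt (by linarith)]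
    refine le_trans ?_ (one_sub_mul_norm_sq_le xp W)
    exact mul_le_mul_of_nonneg_right (by linarith) (sq_nonneg _)
  rw [norm_smul, Real.norm_eq_abs, abs_of_pos (by norm_num : (0:ℝ) < 2)] at h5
  linarith


theorem dfun_eq {S : Set (Matrix (Fin m) (Fin n) ℝ)} {ℓ g : Matrix (Fin m) (Fin n) ℝ → ℝ}
    {ρ r ε : ℝ} {W : Matrix (Fin n) (Fin n) ℝ} {X Z : Matrix (Fin m) (Fin n) ℝ}
    (h : X ∈ S ∧ ∀ X' ∈ S, Ffun ℓ g ρ r ε X W Z ≤ Ffun ℓ g ρ r ε X' W Z) :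
    dfun S ℓ g ρ r ε W Z = Ffun ℓ g ρ r ε X W Z :=
  IsLeast.csInf_eq ⟨Set.mem_image_of_mem _ h.1, Set.forall_mem_image.2 h.2⟩

theorem pfun_eq {S : Set (Matrix (Fin m) (Fin n) ℝ)} {T : Set (Matrix (Fin n) (Fin n) ℝ)}
    {ℓ g : Matrix (Fin m) (Fin n) ℝ → ℝ} {ρ r ε : ℝ}
    {W : Matrix (Fin n) (Fin n) ℝ} {Z : Matrix (Fin m) (Fin n) ℝ} (hW : W ∈ T)
    (h : ∀ W' ∈ T, dfun S ℓ g ρ r ε W' Z ≤ dfun S ℓ g ρ r ε W Z) :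
    pfun S T ℓ g ρ r ε Z = dfun S ℓ g ρ r ε W Z :=
  IsGreatest.csSup_eq ⟨Set.mem_image_of_mem _ hW, Set.forall_mem_image.2 h⟩

/-- The parameter conditions in the form used by the descent argument. -/
theorem parameter_bounds {Lℓ Lg ρ RX RY r ε lam α β μρ Lρ ζ σ₂ ω : ℝ}
    (hLℓ : 0 ≤ Lℓ) (hLg : 0 ≤ Lg) (hRY : 0 ≤ RY) (hRX0 : 0 ≤ RX)
    (hρ : 0 ≤ ρ) (hε : 0 < ε) (hlam : 0 < lam) (hα : 0 < α)
    (hμρ : μρ = (Lℓ + Lg) + 2 * RY + 2 * ρ)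
    (hLρ : Lρ = Lℓ + 2 * RY + 6 * ρ * RX ^ 2 + 2 * ρ)
    (hr : μρ < r) (hαε : α ≤ ε⁻¹)
    (hζ : ζ = (2 * (lam⁻¹ + Lρ) / (r - μρ) + 1) * (Real.sqrt (2 * Lρ / (lam⁻¹ + Lρ)) + 1))
    (hσ₂ : σ₂ = 2 * RX / (r - μρ))
    (hω : ω = (1 / Real.sqrt (r - μρ)) * ((1 + (2 * σ₂ * RX + ε) * α) / (Real.sqrt ε * α)))
    (hrge : max (Lρ + Lg + 4 * RX) (3 * (Lρ + Lg)) ≤ r)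
    (hlamle : lam ≤ 1 / (2 * RX))
    (hαle : α ≤ min (1 / (20 * RX)) (1 / (8 * RX * ζ ^ 2)))
    (hβle : β ≤ 1 / 28 * min (min 1 ((r - μρ) ^ 2 / (2 * α * r * RX ^ 2)))
      (1 / (16 * r * ω ^ 2 * α))) :
    0 < RX ∧ 0 < r ∧ 0 < ζ ∧ 0 ≤ Lρ ∧ Lρ + Lg ≤ r / 3 ∧ 2 * r ≤ 3 * (r - μρ) ∧
      4 * RX ≤ r - μρ ∧ 4 * RX ≤ r ∧ 2 * RX ≤ lam⁻¹ ∧ α * (20 * RX) ≤ 1 ∧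
      α * (8 * RX * ζ ^ 2) ≤ 1 ∧ α * ε ≤ 1 ∧ β ≤ 1 / 28 ∧ β * (448 * (r * ω ^ 2 * α)) ≤ 1 := by
  have hRX : 0 < RX := by
    rcases hRX0.eq_or_lt with h | h
    · rw [← h] at hlamle; norm_num at hlamle; linarith
    · exact h
  have hγ : 0 < r - μρ := sub_pos.2 hr
  have hr0 : 0 < r := by linarith
  have hLρ0 : 0 ≤ Lρ := by rw [hLρ]; positivity
  have hζ0 : 0 < ζ := by rw [hζ]; positivity
  have hσ0 : 0 < σ₂ := by rw [hσ₂]; positivity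
  have hω0 : 0 < ω := by
    have := Real.sqrt_pos.2 hγ
    have := Real.sqrt_pos.2 hε
    rw [hω]; positivity
  have h6 : 0 ≤ 6 * ρ * RX ^ 2 := by positivity
  have hr1 := (le_max_left _ _).trans hrge
  have hr2 := (le_max_right _ _).trans hrge
  have hα1 := hαle.trans (min_le_left _ _)
  have hα2 := hαle.trans (min_le_right _ _)
  rw [le_div_iff₀ (by positivity)] at hα1 hα2
  have hβ1 : β ≤ 1 / 28 * 1 :=
    hβle.trans (mul_le_mul_of_nonneg_left ((min_le_left _ _).trans (min_le_left _ _)) (by norm_num))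
  have hβ2 : β ≤ 1 / 28 * (1 / (16 * r * ω ^ 2 * α)) :=
    hβle.trans (mul_le_mul_of_nonneg_left (min_le_right _ _) (by norm_num))
  have hβ3 : β * (448 * (r * ω ^ 2 * α)) ≤ 1 := by
    have := mul_le_mul_of_nonneg_right hβ2 (by positivity : 0 ≤ 448 * (r * ω ^ 2 * α))
    refine this.trans (le_of_eq ?_)
    field_simp
    norm_num
  have hc : 2 * RX ≤ lam⁻¹ := by
    rw [one_div] at hlamle
    exact (le_inv_comm₀ hlam (by positivity)).1 hlamle
  have hαε' : α * ε ≤ 1 := by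
    have := mul_le_mul_of_nonneg_right hαε hε.le
    rwa [inv_mul_cancel₀ hε.ne'] at this
  refine ⟨hRX, hr0, hζ0, hLρ0, ?_, ?_, ?_, ?_, hc, hα1, hα2, hαε', by linarith, hβ3⟩ <;> linarith

/-- Descent of the potential along one iteration. -/
theorem Phi_descent {gradl : Matrix (Fin m) (Fin n) ℝ → Matrix (Fin m) (Fin n) ℝ}
    {ℓ g : Matrix (Fin m) (Fin n) ℝ → ℝ} (h : IsGradientOf gradl ℓ)
    {S : Set (Matrix (Fin m) (Fin n) ℝ)} {T : Set (Matrix (Fin n) (Fin n) ℝ)}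
    (hS : Convex ℝ S) (hT : Convex ℝ T)
    {Lℓ Lg ρ RX RY r ε c α β Lρ ζ σ₂ ω : ℝ}
    (hρ : 0 ≤ ρ) (hε : 0 < ε) (hα : 0 < α) (hβ0 : 0 < β)
    (hLρ : Lρ = Lℓ + 2 * RY + 6 * ρ * RX ^ 2 + 2 * ρ)
    (hζ : ζ = (2 * (c + Lρ) / (r - (Lℓ + Lg + 2 * RY + 2 * ρ)) + 1)
      * (Real.sqrt (2 * Lρ / (c + Lρ)) + 1))
    (hσ₂ : σ₂ = 2 * RX / (r - (Lℓ + Lg + 2 * RY + 2 * ρ)))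
    (hω : ω = (1 / Real.sqrt (r - (Lℓ + Lg + 2 * RY + 2 * ρ)))
      * ((1 + (2 * σ₂ * RX + ε) * α) / (Real.sqrt ε * α)))
    (hlip : ∀ X ∈ S, ∀ X' ∈ S, ‖gradl X - gradl X'‖ ≤ Lℓ * ‖X - X'‖)
    (hg : ConvexOn ℝ S (fun X => g X + Lg / 2 * ‖X‖ ^ 2))
    (hSR : ∀ X ∈ S, specNorm X ≤ RX) (hTsymm : ∀ W ∈ T, W.IsSymm) (hTR : ∀ W ∈ T, ‖W‖ ≤ RY)
    {xm : Matrix (Fin n) (Fin n) ℝ → Matrix (Fin m) (Fin n) ℝ → Matrix (Fin m) (Fin n) ℝ}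
    (hxm : ∀ Y Z, xm Y Z ∈ S ∧ ∀ X' ∈ S, Ffun ℓ g ρ r ε (xm Y Z) Y Z ≤ Ffun ℓ g ρ r ε X' Y Z)
    (hpar : 0 < RX ∧ 0 < r ∧ 0 < ζ ∧ 0 ≤ Lρ ∧ Lρ + Lg ≤ r / 3 ∧
      2 * r ≤ 3 * (r - (Lℓ + Lg + 2 * RY + 2 * ρ)) ∧
      4 * RX ≤ r - (Lℓ + Lg + 2 * RY + 2 * ρ) ∧ 4 * RX ≤ r ∧ 2 * RX ≤ c ∧ α * (20 * RX) ≤ 1 ∧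
      α * (8 * RX * ζ ^ 2) ≤ 1 ∧ α * ε ≤ 1 ∧ β ≤ 1 / 28 ∧ β * (448 * (r * ω ^ 2 * α)) ≤ 1)
    {x xp z zp : Matrix (Fin m) (Fin n) ℝ} {y yp : Matrix (Fin n) (Fin n) ℝ}
    (hx : x ∈ S) (hxp : xp ∈ S) (hy : y ∈ T) (hyp : yp ∈ T)
    (hmin : ∀ u ∈ S, g xp + ⟪smoothGrad gradl ρ y x, xp - x⟫ + c / 2 * ‖xp - x‖ ^ 2
        + r / 2 * ‖xp - z‖ ^ 2
      ≤ g u + ⟪smoothGrad gradl ρ y x, u - x⟫ + c / 2 * ‖u - x‖ ^ 2 + r / 2 * ‖u - z‖ ^ 2)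
    (hz : zp = z + β • (xp - z))
    (hproj : ∀ u ∈ T, ‖y + α • (Gm xp - ε • y) - yp‖ ≤ ‖y + α • (Gm xp - ε • y) - u‖)
    (hp : ∀ Z, ∃ ys ∈ T, pfun S T ℓ g ρ r ε Z = dfun S ℓ g ρ r ε ys Z ∧
      ∀ u ∈ T, dfun S ℓ g ρ r ε u Z ≤ dfun S ℓ g ρ r ε ys Z) :
    (c / 2 + r / 5) * ‖xp - x‖ ^ 2 + 4 / 5 * (r * β * ‖xp - z‖ ^ 2)
      ≤ Phi S T ℓ g ρ r ε x y z - Phi S T ℓ g ρ r ε xp yp zp := by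
  obtain ⟨hRX, hr0, hζ0, hLρ0, hrL, hγr, hγR, hrR, hcR, hα1, hα2, hα3, hβ1, hβ2⟩ := hpar
  have hγ : 0 < r - (Lℓ + Lg + 2 * RY + 2 * ρ) := by linarith
  have hc : 0 < c := by linarith
  have H := hasGrowthMin_Ffun h hS hρ hlip hg hSR hTsymm hTR hxm
  have hLρ' : Lℓ + 2 * RY + 2 * ρ ≤ Lρ := by
    have : 0 ≤ 6 * ρ * RX ^ 2 := by positivity
    rw [hLρ]; linarith
  obtain ⟨ys, hys, hpeq, hmax⟩ := hp zp
  obtain ⟨yt, -, hpt, hmaxt⟩ := hp z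
  have hd : ∀ W Z, dfun S ℓ g ρ r ε W Z = Ffun ℓ g ρ r ε (xm W Z) W Z := fun W Z => dfun_eq (hxm W Z)
  obtain ⟨hdec, herr⟩ := prox_linear_step hS (h := smoothLag ℓ ρ y) (g := g) (Lg := Lg) (L := Lρ)
    (γ := r - (Lℓ + Lg + 2 * RY + 2 * ρ)) (c := c) (r := r) hγ hc hLρ0 (by linarith) hg
    (v := smoothGrad gradl ρ y x) (z := z) (xs := xm y z) hx
    (fun u hu => by
      obtain ⟨h1, h2⟩ := smoothLag_model h hS hρ hlip hSR (hTsymm y hy) (hTR y hy) hx hu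
      have h3 := mul_le_mul_of_nonneg_right hLρ' (by positivity : 0 ≤ ‖u - x‖ ^ 2 / 2)
      rw [abs_le]
      constructor
      · linarith
      · rw [hLρ]; exact h2)
    hxp hmin (hxm y z).1
    (fun u hu => by
      have := (H y hy z).2 u hu
      rw [← Ffun_eq_regLag, ← Ffun_eq_regLag, Ffun_eq_smoothLag, Ffun_eq_smoothLag] at this
      linarith)
  have hdec' : (c + r / 3) * ‖xp - x‖ ^ 2 ≤ Ffun ℓ g ρ r ε x y z - Ffun ℓ g ρ r ε xp y z := by
    rw [Ffun_eq_smoothLag, Ffun_eq_smoothLag]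
    have := mul_le_mul_of_nonneg_right (by linarith : c + r / 3 ≤ (2 * c + r - Lg - Lρ) / 2)
      (sq_nonneg ‖xp - x‖)
    linarith
  rw [Phi, Phi, hd, hd, hpeq, hd, Ffun_eq_regLag, Ffun_eq_regLag, Ffun_eq_regLag, Ffun_eq_regLag,
    Ffun_eq_regLag]
  refine H.potential_descent hα hβ0 hRX hr0 hγ hε hζ0 hσ₂ hω hγr hγR hrR hcR hα1 hα2 hα3 hβ1 hβ2
    (fun a ha b hb => norm_Gm_sub_le (hSR b hb) (hSR a ha)) hT hxp hy hyp hys hz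
    (fun u hu => inner_le_zero_of_nearest hT hyp hproj hu) (fun u hu => ?_) ?_ ?_ ?_ rfl
  · rw [← Ffun_eq_regLag, ← Ffun_eq_regLag, ← hd, ← hd]
    exact hmax u hu
  · rw [← Ffun_eq_regLag, ← Ffun_eq_regLag]
    exact hdec'
  · rw [hζ]; exact herr
  · rw [← Ffun_eq_regLag, ← hd, hpt]
    exact hmaxt _ hys

theorem residual_sq_le {c r β Δ b D : ℝ} (hc : 0 < c) (hr : 0 < r) (hβ : 0 < β)
    (hβ1 : β ≤ 1 / 28) (hD : (c / 2 + r / 5) * Δ ^ 2 + 4 / 5 * (r * β * b ^ 2) ≤ D) :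
    ((r / 3 + c) * Δ + r * b) ^ 2 ≤ max r c * (7 / (4 * β)) * D := by
  have h1 : ((r / 3 + c) * Δ + r * b) ^ 2
      ≤ 10 * c ^ 2 * Δ ^ 2 + 10 / 9 * r ^ 2 * Δ ^ 2 + 5 / 4 * r ^ 2 * b ^ 2 := by
    nlinarith [sq_nonneg (c * Δ - r / 3 * Δ), sq_nonneg (c * Δ * 2 - r * b / 4),
      sq_nonneg (r / 3 * Δ * 2 - r * b / 4)]
  have h2 : 49 ≤ 7 / (4 * β) := by rw [le_div_iff₀ (by positivity)]; linarith
  have h3 := mul_le_mul_of_nonneg_left hD (by positivity : 0 ≤ 7 / (4 * β))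
  have h4 : 7 / (4 * β) * ((c / 2 + r / 5) * Δ ^ 2 + 4 / 5 * (r * β * b ^ 2))
      = 7 / (4 * β) * ((c / 2 + r / 5) * Δ ^ 2) + 7 / 5 * (r * b ^ 2) := by
    field_simp
  have h5 := mul_le_mul_of_nonneg_right h2 (by positivity : 0 ≤ (c / 2 + r / 5) * Δ ^ 2)
  have hM : 0 < max r c := lt_max_of_lt_left hr
  have h6 : 10 * c * Δ ^ 2 + 10 / 9 * r * Δ ^ 2 + 5 / 4 * r * b ^ 2 ≤ 7 / (4 * β) * D := by
    have : 0 ≤ c * Δ ^ 2 := by positivity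
    have : 0 ≤ r * Δ ^ 2 := by positivity
    have : 0 ≤ r * b ^ 2 := by positivity
    linarith
  have h7 := mul_le_mul_of_nonneg_left h6 hM.le
  have a1 : c ^ 2 * Δ ^ 2 ≤ max r c * (c * Δ ^ 2) := by
    have := mul_le_mul_of_nonneg_right (le_max_right r c) (by positivity : 0 ≤ c * Δ ^ 2)
    linarith
  have a2 : r ^ 2 * Δ ^ 2 ≤ max r c * (r * Δ ^ 2) := by
    have := mul_le_mul_of_nonneg_right (le_max_left r c) (by positivity : 0 ≤ r * Δ ^ 2)
    linarith
  have a3 : r ^ 2 * b ^ 2 ≤ max r c * (r * b ^ 2) := by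
    have := mul_le_mul_of_nonneg_right (le_max_left r c) (by positivity : 0 ≤ r * b ^ 2)
    linarith
  linarith

theorem mul_card_filter_lt_le_sum {a : ℕ → ℝ} (ha : ∀ k, 0 ≤ a k) (τ : ℝ) (K : ℕ) :
    τ * ((Finset.range K).filter fun k => τ < a k).card ≤ ∑ k ∈ Finset.range K, a k := by
  rw [mul_comm, ← nsmul_eq_mul]
  exact (Finset.card_nsmul_le_sum _ _ _ fun k hk => (Finset.mem_filter.1 hk).2.le).trans
    (Finset.sum_le_sum_of_subset_of_nonneg (Finset.filter_subset _ _) fun k _ _ => ha k)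

/-- The potential dominates both the objective lower bound and the regularized Lagrangian. -/
theorem Phi_bounds {S : Set (Matrix (Fin m) (Fin n) ℝ)} {T : Set (Matrix (Fin n) (Fin n) ℝ)}
    {ℓ g : Matrix (Fin m) (Fin n) ℝ → ℝ} {ρ r ε fmin : ℝ} (hρ : 0 ≤ ρ) (hr : 0 ≤ r)
    (hT : (0 : Matrix (Fin n) (Fin n) ℝ) ∈ T) (hf : ∀ X ∈ S, fmin ≤ ℓ X + g X)
    {xm : Matrix (Fin n) (Fin n) ℝ → Matrix (Fin m) (Fin n) ℝ → Matrix (Fin m) (Fin n) ℝ}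
    (hxm : ∀ Y Z, xm Y Z ∈ S ∧ ∀ X' ∈ S, Ffun ℓ g ρ r ε (xm Y Z) Y Z ≤ Ffun ℓ g ρ r ε X' Y Z)
    (hp : ∀ Z, ∃ ys ∈ T, pfun S T ℓ g ρ r ε Z = dfun S ℓ g ρ r ε ys Z ∧
      ∀ u ∈ T, dfun S ℓ g ρ r ε u Z ≤ dfun S ℓ g ρ r ε ys Z)
    {X Z : Matrix (Fin m) (Fin n) ℝ} {Y : Matrix (Fin n) (Fin n) ℝ} (hX : X ∈ S) (hY : Y ∈ T) :
    fmin ≤ Phi S T ℓ g ρ r ε X Y Z ∧ Ffun ℓ g ρ r ε X Y Z ≤ Phi S T ℓ g ρ r ε X Y Z := by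
  obtain ⟨ys, -, hpe, hmax⟩ := hp Z
  have h1 := hmax Y hY
  have h2 := hmax 0 hT
  have h3 : dfun S ℓ g ρ r ε Y Z ≤ Ffun ℓ g ρ r ε X Y Z := by
    rw [dfun_eq (hxm Y Z)]
    exact (hxm Y Z).2 X hX
  have h4 : fmin ≤ dfun S ℓ g ρ r ε 0 Z := by
    rw [dfun_eq (hxm 0 Z), Ffun_eq_smoothLag, smoothLag, frobInner_eq_inner, inner_zero_left,
      norm_zero]
    have := hf _ (hxm 0 Z).1
    have : 0 ≤ ρ / 2 * frobNorm (Gm (xm 0 Z)) ^ 2 := by positivity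
    have : 0 ≤ r / 2 * ‖xm 0 Z - Z‖ ^ 2 := by positivity
    linarith
  rw [← hpe] at h1 h2
  rw [Phi]
  constructor <;> linarith

theorem sum_dual_pairing_nonneg {T : Set (Matrix (Fin n) (Fin n) ℝ)} (hT : Convex ℝ T)
    (hT0 : (0 : Matrix (Fin n) (Fin n) ℝ) ∈ T) {α ε : ℝ} (hα : 0 < α) (hε : 0 < ε)
    (hαε : α * ε ≤ 1) {y w : ℕ → Matrix (Fin n) (Fin n) ℝ} (hy0 : y 0 = 0)
    (hy : ∀ k, y (k + 1) ∈ T)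
    (hproj : ∀ k, ∀ u ∈ T,
      ‖y k + α • (w k - ε • y k) - y (k + 1)‖ ≤ ‖y k + α • (w k - ε • y k) - u‖) (K : ℕ) :
    0 ≤ ∑ k ∈ Finset.range K, (⟪y (k + 1), w k⟫ - ε / 2 * ‖y (k + 1)‖ ^ 2) := by
  have h1 : ∀ k, ‖y (k + 1)‖ ^ 2 / 2 - ‖y k‖ ^ 2 / 2
      ≤ α * (⟪y (k + 1), w k⟫ - ε / 2 * ‖y (k + 1)‖ ^ 2) := by
    intro k
    have h2 := dual_step_lower_bound hαε (inner_le_zero_of_nearest hT (hy k) (hproj k) hT0)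
    have : 0 ≤ α * ε * ‖y k‖ ^ 2 / 2 := by positivity
    linarith
  have h3 := Finset.sum_le_sum fun k (_ : k ∈ Finset.range K) => h1 k
  rw [Finset.sum_range_sub (fun k => ‖y k‖ ^ 2 / 2), hy0, norm_zero, ← Finset.mul_sum] at h3
  have : 0 ≤ ‖y K‖ ^ 2 / 2 := by positivity
  refine nonneg_of_mul_nonneg_right ?_ hα
  linarith

/-- All but a controlled number of the dual iterates stay within the radius `RbY`. -/
theorem card_small_multipliers {ℓ g : Matrix (Fin m) (Fin n) ℝ → ℝ}
    {gradl : Matrix (Fin m) (Fin n) ℝ → Matrix (Fin m) (Fin n) ℝ} (h : IsGradientOf gradl ℓ)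
    {S : Set (Matrix (Fin m) (Fin n) ℝ)} {T : Set (Matrix (Fin n) (Fin n) ℝ)}
    (hS : Convex ℝ S) (hT : Convex ℝ T)
    {Lℓ Lg ρ RX RY r ε c α β Lρ ζ σ₂ ω fmin Φ0 ξ δ RbY : ℝ} {K : ℕ}
    (hLℓ : 0 ≤ Lℓ) (hLg : 0 ≤ Lg)
    (hρ : 0 < ρ) (hε : 0 < ε) (hα : 0 < α) (hβ0 : 0 < β)
    (hLρ : Lρ = Lℓ + 2 * RY + 6 * ρ * RX ^ 2 + 2 * ρ)
    (hζ : ζ = (2 * (c + Lρ) / (r - (Lℓ + Lg + 2 * RY + 2 * ρ)) + 1)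
      * (Real.sqrt (2 * Lρ / (c + Lρ)) + 1))
    (hσ₂ : σ₂ = 2 * RX / (r - (Lℓ + Lg + 2 * RY + 2 * ρ)))
    (hω : ω = (1 / Real.sqrt (r - (Lℓ + Lg + 2 * RY + 2 * ρ)))
      * ((1 + (2 * σ₂ * RX + ε) * α) / (Real.sqrt ε * α)))
    (hlip : ∀ X ∈ S, ∀ X' ∈ S, ‖gradl X - gradl X'‖ ≤ Lℓ * ‖X - X'‖)
    (hg : ConvexOn ℝ S (fun X => g X + Lg / 2 * ‖X‖ ^ 2))
    (hℓLip : ∀ X ∈ S, ∀ X' ∈ S, |ℓ X - ℓ X'| ≤ Lℓ * ‖X - X'‖)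
    (hgLip : ∀ X ∈ S, ∀ X' ∈ S, |g X - g X'| ≤ Lg * ‖X - X'‖)
    (hSR : ∀ X ∈ S, specNorm X ≤ RX) (hTsymm : ∀ W ∈ T, W.IsSymm) (hTR : ∀ W ∈ T, ‖W‖ ≤ RY)
    (hT0 : (0 : Matrix (Fin n) (Fin n) ℝ) ∈ T)
    {xm : Matrix (Fin n) (Fin n) ℝ → Matrix (Fin m) (Fin n) ℝ → Matrix (Fin m) (Fin n) ℝ}
    (hxm : ∀ Y Z, xm Y Z ∈ S ∧ ∀ X' ∈ S, Ffun ℓ g ρ r ε (xm Y Z) Y Z ≤ Ffun ℓ g ρ r ε X' Y Z)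
    (hpar : 0 < RX ∧ 0 < r ∧ 0 < ζ ∧ 0 ≤ Lρ ∧ Lρ + Lg ≤ r / 3 ∧
      2 * r ≤ 3 * (r - (Lℓ + Lg + 2 * RY + 2 * ρ)) ∧
      4 * RX ≤ r - (Lℓ + Lg + 2 * RY + 2 * ρ) ∧ 4 * RX ≤ r ∧ 2 * RX ≤ c ∧ α * (20 * RX) ≤ 1 ∧
      α * (8 * RX * ζ ^ 2) ≤ 1 ∧ α * ε ≤ 1 ∧ β ≤ 1 / 28 ∧ β * (448 * (r * ω ^ 2 * α)) ≤ 1)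
    (hp : ∀ Z, ∃ ys ∈ T, pfun S T ℓ g ρ r ε Z = dfun S ℓ g ρ r ε ys Z ∧
      ∀ u ∈ T, dfun S ℓ g ρ r ε u Z ≤ dfun S ℓ g ρ r ε ys Z)
    (hf : ∀ X ∈ S, fmin ≤ ℓ X + g X)
    (hint : ∀ X : Matrix (Fin m) (Fin n) ℝ, ‖Gm X‖ < 1 →
      ∀ H, ∃ t₀ : ℝ, 0 < t₀ ∧ ∀ t, 0 < t → t ≤ t₀ → X + t • H ∈ S)
    {XS ZS : ℕ → Matrix (Fin m) (Fin n) ℝ} {YS : ℕ → Matrix (Fin n) (Fin n) ℝ}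
    (hX : ∀ k, XS k ∈ S) (hY : ∀ k, YS k ∈ T) (hY0 : YS 0 = 0)
    (hmin : ∀ k, ∀ u ∈ S, g (XS (k + 1)) + ⟪smoothGrad gradl ρ (YS k) (XS k), XS (k + 1) - XS k⟫
        + c / 2 * ‖XS (k + 1) - XS k‖ ^ 2 + r / 2 * ‖XS (k + 1) - ZS k‖ ^ 2
      ≤ g u + ⟪smoothGrad gradl ρ (YS k) (XS k), u - XS k⟫ + c / 2 * ‖u - XS k‖ ^ 2
        + r / 2 * ‖u - ZS k‖ ^ 2)
    (hz : ∀ k, ZS (k + 1) = ZS k + β • (XS (k + 1) - ZS k))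
    (hproj : ∀ k, ∀ u ∈ T, ‖YS k + α • (Gm (XS (k + 1)) - ε • YS k) - YS (k + 1)‖
      ≤ ‖YS k + α • (Gm (XS (k + 1)) - ε • YS k) - u‖)
    (hΦ0 : Φ0 = Phi S T ℓ g ρ r ε (XS 0) (YS 0) (ZS 0))
    (hξ : 0 < ξ) (hδ0 : 0 < δ) (hδ1 : δ < 1)
    (hRbY : ((Lℓ + Lg) + 2 * ρ * RX + max (Real.sqrt r) (Real.sqrt c) * Real.sqrt ξ)
        / (2 * Real.sqrt (1 - δ)) < RbY) :
    (K : ℝ) - (7 / (4 * β * ξ) + 2 * K / (ρ * δ ^ 2)) * (Φ0 - fmin)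
      ≤ ((Finset.range K).filter fun k => ‖YS k‖ < RbY).card := by
  have hdesc := fun k => Phi_descent h hS hT hρ.le hε hα hβ0 hLρ hζ hσ₂ hω hlip hg hSR hTsymm hTR
    hxm hpar (hX k) (hX (k + 1)) (hY k) (hY (k + 1)) (hmin k) (hz k) (hproj k) hp
  obtain ⟨hRX, hr0, -, hLρ0, hrL, -, -, -, hcR, -, -, hα3, hβ1, -⟩ := hpar
  have hc : 0 < c := by linarith
  set Φ : ℕ → ℝ := fun k => Phi S T ℓ g ρ r ε (XS k) (YS k) (ZS k) with hΦ
  have hΦlow : ∀ k, fmin ≤ Φ k ∧ Ffun ℓ g ρ r ε (XS k) (YS k) (ZS k) ≤ Φ k := fun k =>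
    Phi_bounds hρ.le hr0.le hT0 hf hxm hp (hX k) (hY k)
  have hΦ0' : Φ 0 = Φ0 := hΦ0.symm
  have hanti : Antitone Φ := antitone_nat_of_succ_le fun k => by
    have h1 := hdesc k
    have h2 : 0 ≤ (c / 2 + r / 5) * ‖XS (k + 1) - XS k‖ ^ 2
      + 4 / 5 * (r * β * ‖XS (k + 1) - ZS k‖ ^ 2) := by positivity
    exact sub_nonneg.1 (h2.trans h1)
  set a : ℕ → ℝ := fun k =>
    ((r / 3 + c) * ‖XS (k + 1) - XS k‖ + r * ‖XS (k + 1) - ZS k‖) ^ 2 with ha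
  set M := max r c with hM
  have hM0 : 0 < M := lt_max_of_lt_left hr0
  have hsuma : ∑ k ∈ Finset.range K, a k ≤ M * (7 / (4 * β)) * (Φ0 - fmin) := by
    have h1 := Finset.sum_le_sum fun k (_ : k ∈ Finset.range K) =>
      residual_sq_le hc hr0 hβ0 hβ1 (hdesc k)
    refine h1.trans ?_
    rw [← Finset.mul_sum, Finset.sum_range_sub' Φ, hΦ0']
    have := (hΦlow K).1
    gcongr
  have hsumG : ∑ k ∈ Finset.range K, ‖Gm (XS (k + 1))‖ ^ 2 ≤ 2 * K / ρ * (Φ0 - fmin) := by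
    have h1 := sum_dual_pairing_nonneg hT hT0 hα hε hα3 hY0 (fun k => hY (k + 1)) hproj K
    have h2 : ∀ k ∈ Finset.range K, ρ / 2 * ‖Gm (XS (k + 1))‖ ^ 2
        + (⟪YS (k + 1), Gm (XS (k + 1))⟫ - ε / 2 * ‖YS (k + 1)‖ ^ 2) ≤ Φ0 - fmin := by
      intro k _
      have h3 := (hΦlow (k + 1)).2.trans (hanti (Nat.zero_le _))
      rw [hΦ0', Ffun_eq_smoothLag, smoothLag, frobInner_eq_inner, frobNorm_eq_norm] at h3
      have h4 := hf _ (hX (k + 1))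
      have : 0 ≤ r / 2 * ‖XS (k + 1) - ZS (k + 1)‖ ^ 2 := by positivity
      linarith
    have h5 := Finset.sum_le_sum h2
    rw [Finset.sum_add_distrib, ← Finset.mul_sum, Finset.sum_const, Finset.card_range,
      nsmul_eq_mul] at h5
    rw [div_mul_eq_mul_div, le_div_iff₀ hρ]
    linarith
  set A := (Finset.range K).filter fun k => δ ^ 2 < ‖Gm (XS (k + 1))‖ ^ 2 with hA
  set B := (Finset.range K).filter fun k => M * ξ < a k with hB
  have hAcard : (A.card : ℝ) ≤ 2 * K / (ρ * δ ^ 2) * (Φ0 - fmin) := by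
    have h1 := (mul_card_filter_lt_le_sum (a := fun k => ‖Gm (XS (k + 1))‖ ^ 2)
      (fun k => sq_nonneg _) (δ ^ 2) K).trans hsumG
    rw [mul_comm, ← le_div_iff₀ (by positivity)] at h1
    refine h1.trans (le_of_eq ?_)
    field_simp
  have hBcard : (B.card : ℝ) ≤ 7 / (4 * β * ξ) * (Φ0 - fmin) := by
    have h1 := (mul_card_filter_lt_le_sum (a := a) (fun k => sq_nonneg _) (M * ξ) K).trans hsuma
    rw [mul_comm, ← le_div_iff₀ (by positivity)] at h1
    refine h1.trans (le_of_eq ?_)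
    field_simp
  have hsub : Finset.range K \ (A ∪ B) ⊆ (Finset.range K).filter fun k => ‖YS k‖ < RbY := by
    intro k hk
    rw [Finset.mem_sdiff, Finset.mem_union, not_or] at hk
    obtain ⟨hkK, hkA, hkB⟩ := hk
    rw [hA, Finset.mem_filter, not_and, not_lt] at hkA
    rw [hB, Finset.mem_filter, not_and, not_lt] at hkB
    refine Finset.mem_filter.2 ⟨hkK, ?_⟩
    have hfeas : ‖Gm (XS (k + 1))‖ ≤ δ :=
      (sq_le_sq₀ (norm_nonneg _) hδ0.le).1 (hkA hkK)
    have h1 := norm_multiplier_le h hS hLℓ hLg hρ.le hr0.le hc.le hδ1 hlip hℓLip hgLip hSR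
      (hTR _ (hY k)) (hX k) (hX (k + 1)) (hint _ (hfeas.trans_lt hδ1)) hfeas (hmin k)
    rw [← hLρ] at h1
    have h2 := Real.le_sqrt_of_sq_le (hkB hkK)
    have h3 : Real.sqrt (M * ξ) = max (Real.sqrt r) (Real.sqrt c) * Real.sqrt ξ := by
      rw [Real.sqrt_mul hM0.le, hM, Real.sqrt_monotone.map_max]
    rw [h3] at h2
    have h4 := mul_le_mul_of_nonneg_right (by linarith : Lρ ≤ r / 3)
      (norm_nonneg (XS (k + 1) - XS k))
    have hs : 0 < Real.sqrt (1 - δ) := Real.sqrt_pos.2 (by linarith)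
    rw [div_lt_iff₀ (by positivity)] at hRbY
    refine lt_of_mul_lt_mul_left ?_ (by positivity : 0 ≤ 2 * Real.sqrt (1 - δ))
    linarith
  have hcard := Finset.card_le_card hsub
  have h1 := Finset.le_card_sdiff (A ∪ B) (Finset.range K)
  have h2 := Finset.card_union_le A B
  rw [Finset.card_range] at h1
  have h3 : K ≤ ((Finset.range K).filter fun k => ‖YS k‖ < RbY).card + (A.card + B.card) := by
    omega
  have h4 : (K : ℝ) ≤ ((Finset.range K).filter fun k => ‖YS k‖ < RbY).card
      + (A.card + B.card) := by exact_mod_cast h3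
  linarith

end Frobenius

theorem continuous_frobInner {X : Type*} [TopologicalSpace X] {m n : ℕ}
    {A B : X → Matrix (Fin m) (Fin n) ℝ} (hA : Continuous A) (hB : Continuous B) :
    Continuous fun x => frobInner (A x) (B x) :=
  (hA.matrix_transpose.matrix_mul hB).matrix_trace

theorem continuous_frobNorm {X : Type*} [TopologicalSpace X] {m n : ℕ}
    {A : X → Matrix (Fin m) (Fin n) ℝ} (hA : Continuous A) :
    Continuous fun x => frobNorm (A x) :=
  Real.continuous_sqrt.comp (continuous_frobInner hA hA)

theorem exists_dfun_max {m n : ℕ} {S : Set (Matrix (Fin m) (Fin n) ℝ)}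
    {T : Set (Matrix (Fin n) (Fin n) ℝ)} {ℓ g : Matrix (Fin m) (Fin n) ℝ → ℝ} {ρ r ε : ℝ}
    (hT : IsCompact T) (hTne : T.Nonempty)
    {xm : Matrix (Fin n) (Fin n) ℝ → Matrix (Fin m) (Fin n) ℝ → Matrix (Fin m) (Fin n) ℝ}
    (hxm : ∀ Y Z, xm Y Z ∈ S ∧ ∀ X' ∈ S, Ffun ℓ g ρ r ε (xm Y Z) Y Z ≤ Ffun ℓ g ρ r ε X' Y Z)
    (Z : Matrix (Fin m) (Fin n) ℝ) :
    ∃ ys ∈ T, pfun S T ℓ g ρ r ε Z = dfun S ℓ g ρ r ε ys Z ∧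
      ∀ u ∈ T, dfun S ℓ g ρ r ε u Z ≤ dfun S ℓ g ρ r ε ys Z := by
  have husc : UpperSemicontinuousOn (fun W => dfun S ℓ g ρ r ε W Z) T := by
    intro W _ b hb
    have hcont : Continuous fun W' => Ffun ℓ g ρ r ε (xm W Z) W' Z := by
      have h1 := continuous_frobInner (continuous_id (X := Matrix (Fin n) (Fin n) ℝ))
        (continuous_const (y := Gm (xm W Z)))
      have h2 := continuous_frobNorm (continuous_id (X := Matrix (Fin n) (Fin n) ℝ))
      simp only [id] at h1 h2
      simp only [Ffun, Lag]
      fun_prop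
    simp only [dfun_eq (hxm W Z)] at hb
    filter_upwards [mem_nhdsWithin_of_mem_nhds (hcont.continuousAt.eventually_lt_const hb)]
      with W' hW'
    rw [dfun_eq (hxm W' Z)]
    exact ((hxm W' Z).2 _ (hxm W Z).1).trans_lt hW'
  obtain ⟨ys, hys, hmax⟩ := husc.exists_isMaxOn hTne hT
  exact ⟨ys, hys, pfun_eq hys fun u hu => hmax hu, fun u hu => hmax hu⟩

theorem exists_lower_bound_of_lipschitz {m n : ℕ} {S : Set (Matrix (Fin m) (Fin n) ℝ)}
    (hS : IsCompact S) {f : Matrix (Fin m) (Fin n) ℝ → ℝ} {L : ℝ}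
    (hf : ∀ X ∈ S, ∀ X' ∈ S, |f X - f X'| ≤ L * frobNorm (X - X')) :
    ∃ b, ∀ X ∈ S, b ≤ f X := by
  rcases S.eq_empty_or_nonempty with rfl | ⟨X₀, hX₀⟩
  · exact ⟨0, fun X hX => absurd hX (Set.notMem_empty X)⟩
  obtain ⟨C, hC⟩ := hS.bddAbove_image
    (f := fun X => frobNorm (X - X₀)) (continuous_frobNorm (by fun_prop)).continuousOn
  refine ⟨f X₀ - |L| * C, fun X hX => ?_⟩
  have h1 := (abs_le.1 (hf X hX X₀ hX₀)).1
  have h2 : frobNorm (X - X₀) ≤ C := hC (Set.mem_image_of_mem _ hX)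
  have h3 : L * frobNorm (X - X₀) ≤ |L| * C :=
    mul_le_mul (le_abs_self L) h2 (Real.sqrt_nonneg _) (abs_nonneg L)
  linarith

theorem sInf_image_le_of_lipschitz {m n : ℕ} {S : Set (Matrix (Fin m) (Fin n) ℝ)}
    (hS : IsCompact S) {ℓ g : Matrix (Fin m) (Fin n) ℝ → ℝ} {Lℓ Lg : ℝ}
    (hℓ : ∀ X ∈ S, ∀ X' ∈ S, |ℓ X - ℓ X'| ≤ Lℓ * frobNorm (X - X'))
    (hg : ∀ X ∈ S, ∀ X' ∈ S, |g X - g X'| ≤ Lg * frobNorm (X - X'))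
    {X : Matrix (Fin m) (Fin n) ℝ} (hX : X ∈ S) :
    sInf ((fun X => ℓ X + g X) '' S) ≤ ℓ X + g X := by
  obtain ⟨b, hb⟩ := exists_lower_bound_of_lipschitz hS hℓ
  obtain ⟨b', hb'⟩ := exists_lower_bound_of_lipschitz hS hg
  refine csInf_le ⟨b + b', ?_⟩ (Set.mem_image_of_mem (fun X => ℓ X + g X) hX)
  rintro _ ⟨X', hX', rfl⟩
  exact add_le_add (hb X' hX') (hb' X' hX')

theorem exists_segment_near_feasible {m n : ℕ} {X : Matrix (Fin m) (Fin n) ℝ}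
    (hX : frobNorm (Gm X) < 1) (H : Matrix (Fin m) (Fin n) ℝ) :
    ∃ t₀ : ℝ, 0 < t₀ ∧ ∀ t, 0 < t → t ≤ t₀ → frobNorm (Gm (X + t • H)) ≤ 1 := by
  have hline : Continuous fun t : ℝ => X + t • H := by fun_prop
  have hcont : Continuous fun t : ℝ => frobNorm (Gm (X + t • H)) :=
    continuous_frobNorm ((hline.matrix_transpose.matrix_mul hline).sub continuous_const)
  have h0 : frobNorm (Gm (X + (0 : ℝ) • H)) < 1 := by rwa [zero_smul, add_zero]
  obtain ⟨t₀, ht₀, h⟩ := Metric.eventually_nhds_iff.1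
    (hcont.continuousAt.eventually_lt_const h0)
  refine ⟨t₀ / 2, by positivity, fun t h1 h2 => (h ?_).le⟩
  rw [dist_zero_right, Real.norm_eq_abs, abs_of_pos h1]
  linarith

theorem frobNorm_pos {m n : ℕ} {A : Matrix (Fin m) (Fin n) ℝ} (hA : A ≠ 0) : 0 < frobNorm A := by
  let _ := frobNormedAddCommGroup m n
  exact norm_pos_iff.2 hA

theorem frobNorm_sub_le_add {m n : ℕ} (A B : Matrix (Fin m) (Fin n) ℝ) :
    frobNorm A ≤ frobNorm (A - B) + frobNorm B := by
  let _ := frobNormedAddCommGroup m n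
  exact norm_le_norm_sub_add A B

/-- A Lipschitz constant on a set with two distinct points is nonnegative. -/
theorem lipschitz_const_nonneg {m n : ℕ} {S : Set (Matrix (Fin m) (Fin n) ℝ)}
    {f : Matrix (Fin m) (Fin n) ℝ → ℝ} {L : ℝ}
    (hf : ∀ X ∈ S, ∀ X' ∈ S, |f X - f X'| ≤ L * frobNorm (X - X'))
    {X X' : Matrix (Fin m) (Fin n) ℝ} (hX : X ∈ S) (hX' : X' ∈ S) (hne : X ≠ X') : 0 ≤ L :=
  nonneg_of_mul_nonneg_left ((abs_nonneg _).trans (hf X hX X' hX'))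
    (frobNorm_pos (sub_ne_zero.2 hne))

/-- Feasibility of the dual iterates: for all but
`(7/(4βξ) + 2K/(ρδ²))(Φ⁰ − f_min)` of the indices `k ∈ {0,…,K}`, the dual iterate `Y^k`
lies in the interior of `𝒴` relative to the subspace of symmetric matrices. -/
theorem dual_interior_count {m n : ℕ} (hmn : n ≤ m)
    (𝒳 : Set (Matrix (Fin m) (Fin n) ℝ)) (𝒴 : Set (Matrix (Fin n) (Fin n) ℝ))
    (ℓ g : Matrix (Fin m) (Fin n) ℝ → ℝ)
    (gradl : Matrix (Fin m) (Fin n) ℝ → Matrix (Fin m) (Fin n) ℝ)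
    (Lℓ Lg ρ RX RY r ε lam α β μρ Lρ ζ σ₂ ω fmin Φ0 ξ δ RbY : ℝ)
    (K : ℕ)
    (h𝒳conv : Convex ℝ 𝒳) (h𝒳cpt : IsCompact 𝒳)
    (h𝒳R : ∀ X ∈ 𝒳, specNorm X ≤ RX)
    (h𝒳big : {X : Matrix (Fin m) (Fin n) ℝ | frobNorm (Gm X) ≤ 1} ⊆ 𝒳)
    (hgrad : IsGradientOf gradl ℓ) (hgradcont : Continuous gradl)
    (hgradLip : ∀ X ∈ 𝒳, ∀ X' ∈ 𝒳, frobNorm (gradl X - gradl X') ≤ Lℓ * frobNorm (X - X'))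
    (hgwc : ConvexOn ℝ 𝒳 (fun X => g X + Lg / 2 * frobNorm X ^ 2))
    (hℓLip : ∀ X ∈ 𝒳, ∀ X' ∈ 𝒳, |ℓ X - ℓ X'| ≤ Lℓ * frobNorm (X - X'))
    (hgLip : ∀ X ∈ 𝒳, ∀ X' ∈ 𝒳, |g X - g X'| ≤ Lg * frobNorm (X - X'))
    (h𝒴symm : ∀ Y ∈ 𝒴, Y.IsSymm) (h𝒴conv : Convex ℝ 𝒴) (h𝒴cpt : IsCompact 𝒴)
    (h𝒴zero : (0 : Matrix (Fin n) (Fin n) ℝ) ∈ 𝒴)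
    (h𝒴R : ∀ Y ∈ 𝒴, frobNorm Y ≤ RY)
    (hρ : 0 ≤ ρ) (hε : 0 < ε) (hlam : 0 < lam) (hα : 0 < α) (hβ0 : 0 < β) (hβ1 : β < 1)
    (hμρ : μρ = (Lℓ + Lg) + 2 * RY + 2 * ρ)
    (hLρ : Lρ = Lℓ + 2 * RY + 6 * ρ * RX ^ 2 + 2 * ρ)
    (hr : μρ < r) (hlamg : Lg < lam⁻¹) (hαε : α ≤ ε⁻¹)
    (hζ : ζ = (2 * (lam⁻¹ + Lρ) / (r - μρ) + 1) * (Real.sqrt (2 * Lρ / (lam⁻¹ + Lρ)) + 1))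
    (hσ₂ : σ₂ = 2 * RX / (r - μρ))
    (hω : ω = (1 / Real.sqrt (r - μρ)) * ((1 + (2 * σ₂ * RX + ε) * α) / (Real.sqrt ε * α)))
    (hrge : max (Lρ + Lg + 4 * RX) (3 * (Lρ + Lg)) ≤ r)
    (hlamle : lam ≤ 1 / (2 * RX))
    (hαle : α ≤ min (1 / (20 * RX)) (1 / (8 * RX * ζ ^ 2)))
    (hβle : β ≤ 1 / 28 * min (min 1 ((r - μρ) ^ 2 / (2 * α * r * RX ^ 2))) (1 / (16 * r * ω ^ 2 * α)))
    (Xm : Matrix (Fin n) (Fin n) ℝ → Matrix (Fin m) (Fin n) ℝ → Matrix (Fin m) (Fin n) ℝ)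
    (hXm : ∀ Y Z, Xm Y Z ∈ 𝒳 ∧ ∀ X' ∈ 𝒳, Ffun ℓ g ρ r ε (Xm Y Z) Y Z ≤ Ffun ℓ g ρ r ε X' Y Z)
    (proj : Matrix (Fin n) (Fin n) ℝ → Matrix (Fin n) (Fin n) ℝ)
    (hproj : ∀ W, proj W ∈ 𝒴 ∧ ∀ Y' ∈ 𝒴, frobNorm (W - proj W) ≤ frobNorm (W - Y'))
    (XS ZS : ℕ → Matrix (Fin m) (Fin n) ℝ) (YS : ℕ → Matrix (Fin n) (Fin n) ℝ)
    (hX0 : XS 0 ∈ 𝒳) (hX0feas : (XS 0)ᵀ * XS 0 = 1) (hY0 : YS 0 = 0) (hZ0 : ZS 0 = XS 0)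
    (hXit : ∀ k : ℕ, XS (k + 1) ∈ 𝒳 ∧ ∀ X' ∈ 𝒳,
      LinLag ℓ g gradl ρ lam (XS k) (XS (k + 1)) (YS k)
          + r / 2 * frobNorm (XS (k + 1) - ZS k) ^ 2
        ≤ LinLag ℓ g gradl ρ lam (XS k) X' (YS k) + r / 2 * frobNorm (X' - ZS k) ^ 2)
    (hZit : ∀ k : ℕ, ZS (k + 1) = ZS k + β • (XS (k + 1) - ZS k))
    (hYit : ∀ k : ℕ, YS (k + 1) = proj (YS k + α • (Gm (XS (k + 1)) - ε • YS k)))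
    (hfmin : fmin = sInf ((fun X => ℓ X + g X) '' 𝒳))
    (hΦ0 : Φ0 = Phi 𝒳 𝒴 ℓ g ρ r ε (XS 0) (YS 0) (ZS 0))
    (hξ : 0 < ξ) (hδ0 : 0 < δ) (hδ1 : δ < 1) (hK : 1 ≤ K)
    (hρbig : 2 * (Φ0 - fmin) / δ ^ 2 < ρ)
    (hKbig : (7 / (4 * β * ξ) + 2 * K / (ρ * δ ^ 2)) * (Φ0 - fmin) < (K : ℝ))
    (h𝒴ball : {Y : Matrix (Fin n) (Fin n) ℝ | Y.IsSymm ∧ frobNorm Y ≤ RbY} ⊆ 𝒴)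
    (hRbY : RbY ≤ RY)
    (hRbYbig : ((Lℓ + Lg) + 2 * ρ * RX + max (Real.sqrt r) (Real.sqrt lam⁻¹) * Real.sqrt ξ)
        / (2 * Real.sqrt (1 - δ)) < RbY) :
    (K : ℝ) - (7 / (4 * β * ξ) + 2 * K / (ρ * δ ^ 2)) * (Φ0 - fmin)
      ≤ (({k : ℕ | k ≤ K ∧ YS k ∈ 𝒴 ∧ ∃ η : ℝ, 0 < η ∧
            ∀ Y' : Matrix (Fin n) (Fin n) ℝ, Y'.IsSymm → frobNorm (Y' - YS k) < η → Y' ∈ 𝒴}.ncard : ℝ)) := by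
  have hY : ∀ k, YS k ∈ 𝒴 := by
    rintro (_ | k)
    · rw [hY0]; exact h𝒴zero
    · rw [hYit]; exact (hproj _).1
  have hX : ∀ k, XS k ∈ 𝒳 := by
    rintro (_ | k)
    · exact hX0
    · exact (hXit k).1
  have hf : ∀ X ∈ 𝒳, fmin ≤ ℓ X + g X := fun X hX => by
    rw [hfmin]; exact sInf_image_le_of_lipschitz h𝒳cpt hℓLip hgLip hX
  have hfinite : {k : ℕ | k ≤ K ∧ YS k ∈ 𝒴 ∧ ∃ η : ℝ, 0 < η ∧
      ∀ Y' : Matrix (Fin n) (Fin n) ℝ, Y'.IsSymm → frobNorm (Y' - YS k) < η → Y' ∈ 𝒴}.Finite :=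
    (Set.finite_Iic K).subset fun k hk => hk.1
  have hp := exists_dfun_max (ℓ := ℓ) (g := g) (ρ := ρ) (r := r) (ε := ε) h𝒴cpt ⟨0, h𝒴zero⟩ hXm
  rcases Nat.eq_zero_or_pos n with rfl | hn
  · have hΦ : fmin ≤ Φ0 := by
      obtain ⟨ys, -, hpe, -⟩ := hp (ZS 0)
      have e : Phi 𝒳 𝒴 ℓ g ρ r ε (XS 0) (YS 0) (ZS 0) = ℓ (XS 0) + g (XS 0) := by
        rw [Phi, hpe, Subsingleton.elim ys (YS 0), dfun_eq (hXm _ _),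
          Subsingleton.elim (Xm (YS 0) (ZS 0)) (XS 0)]
        simp [Ffun, Lag, frobNorm, frobInner, Matrix.trace]
      rw [hΦ0, e]
      exact hf _ hX0
    have hsub : (Finset.range K : Set ℕ) ⊆ {k : ℕ | k ≤ K ∧ YS k ∈ 𝒴 ∧ ∃ η : ℝ, 0 < η ∧
        ∀ Y' : Matrix (Fin 0) (Fin 0) ℝ, Y'.IsSymm → frobNorm (Y' - YS k) < η → Y' ∈ 𝒴} :=
      fun k hk => ⟨(Finset.mem_range.1 hk).le, hY k, 1, one_pos, fun Y' _ _ => by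
        rw [Subsingleton.elim Y' 0]; exact h𝒴zero⟩
    have hcard := Set.ncard_le_ncard hsub hfinite
    rw [Set.ncard_coe_finset, Finset.card_range] at hcard
    have h1 : (K : ℝ) ≤ _ := Nat.cast_le.2 hcard
    have h2 : 0 ≤ (7 / (4 * β * ξ) + 2 * K / (ρ * δ ^ 2)) * (Φ0 - fmin) :=
      mul_nonneg (by positivity) (sub_nonneg.2 hΦ)
    linarith
  · have hfeas : XS 0 ≠ -XS 0 := by
      intro h
      have h0 : XS 0 = 0 := by
        ext i j
        have h1 := congrFun (congrFun h i) j
        rw [Matrix.neg_apply] at h1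
        rw [Matrix.zero_apply]
        linarith
      rw [h0, Matrix.mul_zero] at hX0feas
      have := congrFun (congrFun hX0feas ⟨0, hn⟩) ⟨0, hn⟩
      simp at this
    have hneg : -XS 0 ∈ 𝒳 := h𝒳big (by
      simp [Gm, hX0feas, frobNorm, frobInner])
    have hLℓ := lipschitz_const_nonneg hℓLip hX0 hneg hfeas
    have hLg := lipschitz_const_nonneg hgLip hX0 hneg hfeas
    have hRX : 0 ≤ RX := (specNorm_nonneg _).trans (h𝒳R _ hX0)
    have hRY : 0 ≤ RY := (Real.sqrt_nonneg _).trans (h𝒴R _ h𝒴zero)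
    have hpar := parameter_bounds hLℓ hLg hRY hRX hρ hε hlam hα hμρ hLρ hr hαε hζ hσ₂ hω hrge
      hlamle hαle hβle
    have hr0 := hpar.2.1
    have hΦ : fmin ≤ Φ0 := by
      rw [hΦ0]
      exact (Phi_bounds hρ hr0.le h𝒴zero hf hXm hp hX0 (hY 0)).1
    have hρ0 : 0 < ρ := lt_of_le_of_lt
      (div_nonneg (mul_nonneg zero_le_two (sub_nonneg.2 hΦ)) (sq_nonneg δ)) hρbig
    subst hμρ
    have hmain := card_small_multipliers (K := K) hgrad h𝒳conv h𝒴conv hLℓ hLg hρ0 hε hα hβ0 hLρ hζ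
      hσ₂ hω hgradLip hgwc hℓLip hgLip h𝒳R h𝒴symm h𝒴R h𝒴zero hXm hpar hp hf
      (fun X hX H => by
        obtain ⟨t₀, ht₀, h⟩ := exists_segment_near_feasible hX H
        exact ⟨t₀, ht₀, fun t h1 h2 => h𝒳big (h t h1 h2)⟩)
      hX hY hY0
      (fun k u hu => by
        have := (hXit k).2 u hu
        rw [LinLag_eq, LinLag_eq] at this
        simp only [frobNorm_eq_norm] at this
        linarith)
      hZit (fun k u hu => by rw [hYit]; exact (hproj _).2 u hu) hΦ0 hξ hδ0 hδ1 hRbYbig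
    refine hmain.trans (Nat.cast_le.2 ?_)
    rw [← Set.ncard_coe_finset]
    refine Set.ncard_le_ncard (fun k hk => ?_) hfinite
    obtain ⟨hk1, hk2⟩ := Finset.mem_filter.1 hk
    refine ⟨(Finset.mem_range.1 hk1).le, hY k, RbY - frobNorm (YS k), sub_pos.2 hk2,
      fun Y' hsymm hY' => h𝒴ball ⟨hsymm, ?_⟩⟩
    linarith [frobNorm_sub_le_add Y' (YS k)]

end
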